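/- arXiv:2207.07770 — 5 statements merged into one kernel-verified Lean document; each statement's English description precedes it below -/
import Mathlib

section
/- Theorem A (case of two curves). Let k be an algebraically closed field of characteristic zero and let Q₁,Q₂,Q₃,Q₄ ∈ k[x₁,x₂,x₃,x₄] be homogeneous quadratic forms such that each of the pairs (Q₁,Q₂) and (Q₃,Q₄) cuts out a normal elliptic curve in P³. Then the Jacobian brackets {·,·}_{Q₁,Q₂} and {·,·}_{Q₃,Q₄} are compatible (i.e., their mixed Jacobiator J(f,g,h) vanishes for all f,g,h ∈ k[x₁,…,x₄]) if and only if the pencils span{Q₁,Q₂} and span{Q₃,Q₄} have nonzero intersection (equivalently, iff Q₁,Q₂,Q₃,Q₄ are linearly dependent, i.e., the two elliptic curves lie on a common, possibly singular, quadric surface). -/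
open MvPolynomial

noncomputable section

/-- The Jacobian bracket `{f,g}_{P,Q}`: the determinant of the 4×4 matrix whose
columns are the gradients ∇f, ∇g, ∇P, ∇Q. -/
def jacBracket {k : Type*} [Field k] (P Q f g : MvPolynomial (Fin 4) k) :
    MvPolynomial (Fin 4) k :=
  Matrix.det (Matrix.of fun i j => pderiv i (![f, g, P, Q] j))

/-- Mixed Jacobiator of two brackets. -/
def mixedJacobiator {k : Type*} [Field k]
    (b₁ b₂ : MvPolynomial (Fin 4) k → MvPolynomial (Fin 4) k → MvPolynomial (Fin 4) k)
    (f g h : MvPolynomial (Fin 4) k) : MvPolynomial (Fin 4) k :=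
  b₂ (b₁ f g) h + b₂ (b₁ g h) f + b₂ (b₁ h f) g +
    b₁ (b₂ f g) h + b₁ (b₂ g h) f + b₁ (b₂ h f) g

/-- The gradient of `Q` evaluated at `v`. -/
def gradEval {k : Type*} [Field k] (Q : MvPolynomial (Fin 4) k) (v : Fin 4 → k) :
    Fin 4 → k :=
  fun i => eval v (pderiv i Q)

/-- The pair of quadrics `(Q₁, Q₂)` cuts out a normal elliptic curve in `P³`:
at every nonzero common zero, the gradients are linearly independent. -/
def CutsOutEllipticCurve {k : Type*} [Field k] (Q₁ Q₂ : MvPolynomial (Fin 4) k) : Prop :=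
  ∀ v : Fin 4 → k, v ≠ 0 → eval v Q₁ = 0 → eval v Q₂ = 0 →
    LinearIndependent k ![gradEval Q₁ v, gradEval Q₂ v]

/-- The value on two covectors of the bivector with upper triangular entries `w i j`. -/
def bivectorEval {R : Type*} [CommRing R] (w : Fin 4 → Fin 4 → R) (u v : Fin 4 → R) : R :=
  w 0 1 * (u 0 * v 1 - u 1 * v 0) + w 0 2 * (u 0 * v 2 - u 2 * v 0) +
    w 0 3 * (u 0 * v 3 - u 3 * v 0) + w 1 2 * (u 1 * v 2 - u 2 * v 1) +
    w 1 3 * (u 1 * v 3 - u 3 * v 1) + w 2 3 * (u 2 * v 3 - u 3 * v 2)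

/-- The entries of the bivector of the Jacobian bracket of two functions with gradients
`p` and `q`. -/
def jacCoeff {R : Type*} [CommRing R] (p q : Fin 4 → R) : Fin 4 → Fin 4 → R :=
  ![![0, p 2 * q 3 - p 3 * q 2, p 3 * q 1 - p 1 * q 3, p 1 * q 2 - p 2 * q 1],
    ![0, 0, p 0 * q 3 - p 3 * q 0, p 2 * q 0 - p 0 * q 2],
    ![0, 0, 0, p 0 * q 1 - p 1 * q 0],
    ![0, 0, 0, 0]]

theorem jacBracket_eq_bivectorEval {k : Type*} [Field k] (P Q f g : MvPolynomial (Fin 4) k) :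
    jacBracket P Q f g =
      bivectorEval (jacCoeff (fun i => pderiv i P) (fun i => pderiv i Q))
        (fun i => pderiv i f) (fun i => pderiv i g) := by
  simp [jacBracket, bivectorEval, jacCoeff, Matrix.det_succ_row_zero, Fin.sum_univ_succ,
    Fin.succAbove]
  ring

theorem pderiv_pderiv_comm {k : Type*} [Field k] (i j : Fin 4) (f : MvPolynomial (Fin 4) k) :
    pderiv i (pderiv j f) = pderiv j (pderiv i f) := by
  have h : ⁅(pderiv i : Derivation k (MvPolynomial (Fin 4) k) (MvPolynomial (Fin 4) k)),
      (pderiv j : Derivation k (MvPolynomial (Fin 4) k) (MvPolynomial (Fin 4) k))⁆ = 0 := by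
    apply MvPolynomial.derivation_ext
    intro l
    rw [Derivation.commutator_apply]
    simp [pderiv_X, Pi.single_apply, apply_ite]
  have := congrArg (fun D => D f) h
  simpa [Derivation.commutator_apply, sub_eq_zero] using this

theorem pderiv_bivectorEval {k : Type*} [Field k] (l : Fin 4)
    (w : Fin 4 → Fin 4 → MvPolynomial (Fin 4) k) (u v : Fin 4 → MvPolynomial (Fin 4) k) :
    pderiv l (bivectorEval w u v) =
      bivectorEval (fun i j => pderiv l (w i j)) u v +
        bivectorEval w (fun i => pderiv l (u i)) v +
        bivectorEval w u (fun i => pderiv l (v i)) := by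
  simp only [bivectorEval, map_add, map_sub, Derivation.leibniz, smul_eq_mul]
  ring

theorem bivectorEval_add_left {R : Type*} [CommRing R] (w : Fin 4 → Fin 4 → R)
    (u u' v : Fin 4 → R) :
    bivectorEval w (fun i => u i + u' i) v = bivectorEval w u v + bivectorEval w u' v := by
  simp only [bivectorEval]
  ring

/-- The contributions of the Hessian of one argument to the mixed Jacobiator cancel. -/
theorem bivectorEval_hessian {R : Type*} [CommRing R] (w p : Fin 4 → Fin 4 → R)
    (F : Fin 4 → Fin 4 → R) (hF : ∀ i j, F i j = F j i) (g h : Fin 4 → R) :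
    bivectorEval p (fun l => bivectorEval w (F l) g) h +
      bivectorEval p (fun l => bivectorEval w h (F l)) g +
      bivectorEval w (fun l => bivectorEval p (F l) g) h +
      bivectorEval w (fun l => bivectorEval p h (F l)) g = 0 := by
  simp only [bivectorEval]
  rw [hF 1 0, hF 2 0, hF 3 0, hF 2 1, hF 3 1, hF 3 2]
  ring

/-- The derivatives of the coefficients of the first bivector, contracted with the second. -/
def bivectorContract {R : Type*} [CommRing R] (dw : Fin 4 → Fin 4 → Fin 4 → R)
    (p : Fin 4 → Fin 4 → R) (f g h : Fin 4 → R) : R :=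
  bivectorEval p (fun l => bivectorEval (dw l) f g) h +
    bivectorEval p (fun l => bivectorEval (dw l) g h) f +
    bivectorEval p (fun l => bivectorEval (dw l) h f) g

theorem mixedJacobiator_jacBracket_eq_bivectorContract {k : Type*} [Field k]
    (P Q R S f g h : MvPolynomial (Fin 4) k) :
    mixedJacobiator (jacBracket P Q) (jacBracket R S) f g h =
      bivectorContract
          (fun l i j => pderiv l (jacCoeff (fun i => pderiv i P) (fun i => pderiv i Q) i j))
          (jacCoeff (fun i => pderiv i R) (fun i => pderiv i S))
          (fun i => pderiv i f) (fun i => pderiv i g) (fun i => pderiv i h) +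
        bivectorContract
          (fun l i j => pderiv l (jacCoeff (fun i => pderiv i R) (fun i => pderiv i S) i j))
          (jacCoeff (fun i => pderiv i P) (fun i => pderiv i Q))
          (fun i => pderiv i f) (fun i => pderiv i g) (fun i => pderiv i h) := by
  simp only [mixedJacobiator, jacBracket_eq_bivectorEval]
  generalize jacCoeff (fun i => pderiv i P) (fun i => pderiv i Q) = w
  generalize jacCoeff (fun i => pderiv i R) (fun i => pderiv i S) = p
  simp only [pderiv_bivectorEval, bivectorEval_add_left, bivectorContract]
  have hf := bivectorEval_hessian w p (fun i j => pderiv i (pderiv j f))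
    (fun i j => pderiv_pderiv_comm i j f) (fun i => pderiv i g) (fun i => pderiv i h)
  have hg := bivectorEval_hessian w p (fun i j => pderiv i (pderiv j g))
    (fun i j => pderiv_pderiv_comm i j g) (fun i => pderiv i h) (fun i => pderiv i f)
  have hh := bivectorEval_hessian w p (fun i j => pderiv i (pderiv j h))
    (fun i j => pderiv_pderiv_comm i j h) (fun i => pderiv i f) (fun i => pderiv i g)
  linear_combination hf + hg + hh

/-- `bivectorContract` is a trivector: it is the sum of its values on triples of standard basis
covectors times the corresponding `3 × 3` minors. -/
theorem bivectorContract_eq {R : Type*} [CommRing R] (dw : Fin 4 → Fin 4 → Fin 4 → R)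
    (p : Fin 4 → Fin 4 → R) (f g h : Fin 4 → R) :
    bivectorContract dw p f g h =
      ∑ m : Fin 4, bivectorContract dw p (Pi.single (m.succAbove 0) 1)
        (Pi.single (m.succAbove 1) 1) (Pi.single (m.succAbove 2) 1) *
        (Matrix.of fun i j : Fin 3 => ![f, g, h] j (m.succAbove i)).det := by
  simp [bivectorContract, bivectorEval, Fin.sum_univ_succ, Fin.succAbove, Pi.single_apply,
    Matrix.det_fin_three]
  ring

theorem bivectorContract_jacCoeff_single {A : Type*} [CommRing A] (p q r s : Fin 4 → A)
    (P Q R S : Fin 4 → Fin 4 → A) (hP : ∀ i j, P i j = P j i) (hQ : ∀ i j, Q i j = Q j i)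
    (hR : ∀ i j, R i j = R j i) (hS : ∀ i j, S i j = S j i) (m : Fin 4) :
    bivectorContract (fun l i j => jacCoeff (P l) q i j + jacCoeff p (Q l) i j) (jacCoeff r s)
          (Pi.single (m.succAbove 0) 1) (Pi.single (m.succAbove 1) 1)
          (Pi.single (m.succAbove 2) 1) +
        bivectorContract (fun l i j => jacCoeff (R l) s i j + jacCoeff r (S l) i j) (jacCoeff p q)
          (Pi.single (m.succAbove 0) 1) (Pi.single (m.succAbove 1) 1)
          (Pi.single (m.succAbove 2) 1) =
      (-1) ^ (m : ℕ) *
        (bivectorEval (fun i j => jacCoeff (P m) q i j + jacCoeff p (Q m) i j) r s +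
          bivectorEval (jacCoeff p q) (R m) s + bivectorEval (jacCoeff p q) r (S m)) := by
  fin_cases m <;>
  · simp [bivectorContract, bivectorEval, Fin.succAbove, jacCoeff]
    simp only [hP 1 0, hP 2 0, hP 3 0, hP 2 1, hP 3 1, hP 3 2, hQ 1 0, hQ 2 0, hQ 3 0, hQ 2 1,
      hQ 3 1, hQ 3 2, hR 1 0, hR 2 0, hR 3 0, hR 2 1, hR 3 1, hR 3 2, hS 1 0, hS 2 0, hS 3 0,
      hS 2 1, hS 3 1, hS 3 2]
    ring

theorem pderiv_jacCoeff {k : Type*} [Field k] (P Q : MvPolynomial (Fin 4) k) (l i j : Fin 4) :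
    pderiv l (jacCoeff (fun i => pderiv i P) (fun i => pderiv i Q) i j) =
      jacCoeff (fun i => pderiv l (pderiv i P)) (fun i => pderiv i Q) i j +
        jacCoeff (fun i => pderiv i P) (fun i => pderiv l (pderiv i Q)) i j := by
  fin_cases i <;> fin_cases j <;> simp [jacCoeff] <;> ring

theorem bivectorContract_single {k : Type*} [Field k] (P Q R S : MvPolynomial (Fin 4) k)
    (m : Fin 4) :
    bivectorContract
          (fun l i j => pderiv l (jacCoeff (fun i => pderiv i P) (fun i => pderiv i Q) i j))
          (jacCoeff (fun i => pderiv i R) (fun i => pderiv i S))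
          (Pi.single (m.succAbove 0) 1) (Pi.single (m.succAbove 1) 1)
          (Pi.single (m.succAbove 2) 1) +
        bivectorContract
          (fun l i j => pderiv l (jacCoeff (fun i => pderiv i R) (fun i => pderiv i S) i j))
          (jacCoeff (fun i => pderiv i P) (fun i => pderiv i Q))
          (Pi.single (m.succAbove 0) 1) (Pi.single (m.succAbove 1) 1)
          (Pi.single (m.succAbove 2) 1) =
      (-1) ^ (m : ℕ) * pderiv m (jacBracket P Q R S) := by
  rw [jacBracket_eq_bivectorEval, pderiv_bivectorEval]
  simp only [pderiv_jacCoeff]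
  exact bivectorContract_jacCoeff_single _ _ _ _ (fun l i => pderiv l (pderiv i P))
    (fun l i => pderiv l (pderiv i Q)) (fun l i => pderiv l (pderiv i R))
    (fun l i => pderiv l (pderiv i S)) (fun _ _ => pderiv_pderiv_comm _ _ _)
    (fun _ _ => pderiv_pderiv_comm _ _ _) (fun _ _ => pderiv_pderiv_comm _ _ _)
    (fun _ _ => pderiv_pderiv_comm _ _ _) m

theorem mixedJacobiator_jacBracket {k : Type*} [Field k] (P Q R S f g h : MvPolynomial (Fin 4) k) :
    mixedJacobiator (jacBracket P Q) (jacBracket R S) f g h =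
      ∑ m : Fin 4, (-1) ^ (m : ℕ) * pderiv m (jacBracket P Q R S) *
        (Matrix.of fun i j : Fin 3 => pderiv (m.succAbove i) (![f, g, h] j)).det := by
  rw [mixedJacobiator_jacBracket_eq_bivectorContract, bivectorContract_eq,
    bivectorContract_eq _ (jacCoeff (fun i => pderiv i P) (fun i => pderiv i Q)),
    ← Finset.sum_add_distrib]
  refine Finset.sum_congr rfl fun m _ => ?_
  rw [← add_mul, bivectorContract_single]
  congr 2
  ext i j : 2
  fin_cases j <;> rfl

theorem jacBracket_isHomogeneous {k : Type*} [Field k] {P Q R S : MvPolynomial (Fin 4) k}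
    (hP : P.IsHomogeneous 2) (hQ : Q.IsHomogeneous 2)
    (hR : R.IsHomogeneous 2) (hS : S.IsHomogeneous 2) :
    (jacBracket P Q R S).IsHomogeneous 4 := by
  rw [jacBracket, Matrix.det_apply]
  refine IsHomogeneous.sum _ _ _ fun σ _ => ?_
  have h : (∏ i, Matrix.of (fun i j => pderiv i (![R, S, P, Q] j)) (σ i) i).IsHomogeneous
      (∑ _i : Fin 4, 1) := by
    refine IsHomogeneous.prod _ _ _ fun j _ => ?_
    fin_cases j
    exacts [hR.pderiv, hS.pderiv, hP.pderiv, hQ.pderiv]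
  rcases Int.units_eq_one_or (Equiv.Perm.sign σ) with hs | hs
  · simpa [hs] using h
  · simpa [hs] using h.neg

theorem mixedJacobiator_jacBracket_eq_zero_iff {k : Type*} [Field k] [CharZero k]
    {P Q R S : MvPolynomial (Fin 4) k}
    (hP : P.IsHomogeneous 2) (hQ : Q.IsHomogeneous 2)
    (hR : R.IsHomogeneous 2) (hS : S.IsHomogeneous 2) :
    (∀ f g h, mixedJacobiator (jacBracket P Q) (jacBracket R S) f g h = 0) ↔
      jacBracket P Q R S = 0 := by
  refine ⟨fun H => ?_, fun H f g h => by simp [mixedJacobiator_jacBracket, H]⟩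
  have hd : ∀ m, pderiv m (jacBracket P Q R S) = 0 := by
    intro m
    have := H (X (m.succAbove 0)) (X (m.succAbove 1)) (X (m.succAbove 2))
    rw [mixedJacobiator_jacBracket_eq_bivectorContract] at this
    have hX : ∀ j : Fin 4, (fun i => pderiv i (X j : MvPolynomial (Fin 4) k)) = Pi.single j 1 := by
      intro j
      ext1 i
      rw [pderiv_X, Pi.single_apply, Pi.single_apply]
      simp only [eq_comm]
    rw [hX, hX, hX, bivectorContract_single] at this
    simpa using this
  have he := (jacBracket_isHomogeneous hP hQ hR hS).sum_X_mul_pderiv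
  simpa [hd] using he

theorem jacBracket_eq_zero_of_not_linearIndependent {k : Type*} [Field k]
    {P Q R S : MvPolynomial (Fin 4) k} (h : ¬ LinearIndependent k ![P, Q, R, S]) :
    jacBracket P Q R S = 0 := by
  obtain ⟨c, hc, i, hi⟩ := Fintype.not_linearIndependent_iff.mp h
  rw [jacBracket]
  refine Matrix.exists_mulVec_eq_zero_iff.mp ⟨![C (c 2), C (c 3), C (c 0), C (c 1)], ?_, ?_⟩
  · intro h0
    have e0 := congrFun h0 0
    have e1 := congrFun h0 1
    have e2 := congrFun h0 2
    have e3 := congrFun h0 3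
    fin_cases i <;> simp_all
  · ext1 l
    have := congrArg (pderiv l) hc
    simp [Fin.sum_univ_succ, Matrix.mulVec, dotProduct, smul_eq_C_mul] at this ⊢
    linear_combination this

/-- The determinant of the four vectors `a * w`, `b * w`, `E w`, `F w`. -/
def pencilDet {k : Type*} [Field k] (a b : Fin 4 → k) (E F : Matrix (Fin 4) (Fin 4) k)
    (w : Fin 4 → k) : k :=
  (Matrix.of fun r c => ![a r * w r, b r * w r, (E.mulVec w) r, (F.mulVec w) r] c).det

theorem pencilDet_smul_add {k : Type*} [Field k] (a b : Fin 4 → k)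
    (C D : Matrix (Fin 4) (Fin 4) k) (s t s' t' : k) (w : Fin 4 → k) :
    pencilDet a b (s • C + t • D) (s' • C + t' • D) w = (s * t' - t * s') * pencilDet a b C D w := by
  simp only [pencilDet, Matrix.add_mulVec, Matrix.smul_mulVec]
  generalize C.mulVec w = c
  generalize D.mulVec w = d
  simp [Matrix.det_succ_row_zero, Fin.sum_univ_succ, Fin.succAbove]
  ring

theorem pencilDet_submatrix {k : Type*} [Field k] (a b : Fin 4 → k)
    (C D : Matrix (Fin 4) (Fin 4) k) (σ : Equiv.Perm (Fin 4)) (w : Fin 4 → k) :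
    pencilDet (a ∘ σ) (b ∘ σ) (C.submatrix σ σ) (D.submatrix σ σ) (w ∘ σ) =
      Equiv.Perm.sign σ * pencilDet a b C D w := by
  rw [pencilDet, pencilDet, ← Matrix.det_permute]
  congr 1
  ext r c
  have h : ∀ M : Matrix (Fin 4) (Fin 4) k,
      (M.submatrix σ σ).mulVec (w ∘ σ) r = M.mulVec w (σ r) := by
    intro M
    simp only [Matrix.mulVec, dotProduct, Matrix.submatrix_apply, Function.comp]
    exact Equiv.sum_comp σ fun i => M (σ r) i * w i
  fin_cases c <;> simp [h]

theorem eq_diagonal_of_pencilDet_eq_zero {k : Type*} [Field k] [CharZero k]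
    {a b : Fin 4 → k} (hab : ∀ i j, i ≠ j → a i * b j - a j * b i ≠ 0)
    {E F : Matrix (Fin 4) (Fin 4) k} (hE : E.IsSymm) (hF : F.IsSymm)
    (H : ∀ w, pencilDet a b E F w = 0) (hE01 : E 0 1 = 0) (hF01 : F 0 1 ≠ 0) :
    ∃ s t : k, E = s • Matrix.diagonal a + t • Matrix.diagonal b := by
  have sE : ∀ i j, E i j = E j i := fun i j => hE.apply j i
  have sF : ∀ i j, F i j = F j i := fun i j => hF.apply j i
  simp only [pencilDet, Matrix.det_succ_row_zero, Fin.sum_univ_succ, Matrix.mulVec, dotProduct] at H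
  simp [Fin.succAbove] at H
  simp only [sE 1 0, sE 2 0, sE 3 0, sE 2 1, sE 3 1, sE 3 2, sF 1 0, sF 2 0, sF 3 0, sF 2 1,
    sF 3 1, sF 3 2, hE01] at H
  have h02 : E 0 2 = 0 := by
    have h1 := H ![1, 0, 0, 1]
    have h2 := H ![1, 0, 0, -1]
    have h3 := H ![2, 0, 0, 1]
    simp at h1 h2 h3
    have : (a 0 * b 3 - a 3 * b 0) * F 0 1 * E 0 2 = 0 := by
      linear_combination -(h3 - 3 * h1 - h2) / 6
    simpa [hab 0 3 (by decide), hF01] using this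
  have h03 : E 0 3 = 0 := by
    have h1 := H ![1, 0, 1, 0]
    have h2 := H ![1, 0, -1, 0]
    have h3 := H ![2, 0, 1, 0]
    simp at h1 h2 h3
    have : (a 0 * b 2 - a 2 * b 0) * F 0 1 * E 0 3 = 0 := by
      linear_combination (h3 - 3 * h1 - h2) / 6
    simpa [hab 0 2 (by decide), hF01] using this
  have h12 : E 1 2 = 0 := by
    have h1 := H ![0, 1, 0, 1]
    have h2 := H ![0, 1, 0, -1]
    have h3 := H ![0, 2, 0, 1]
    simp at h1 h2 h3
    have : (a 1 * b 3 - a 3 * b 1) * F 0 1 * E 1 2 = 0 := by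
      linear_combination (h3 - 3 * h1 - h2) / 6
    simpa [hab 1 3 (by decide), hF01] using this
  have h13 : E 1 3 = 0 := by
    have h1 := H ![0, 1, 1, 0]
    have h2 := H ![0, 1, -1, 0]
    have h3 := H ![0, 2, 1, 0]
    simp at h1 h2 h3
    have : (a 1 * b 2 - a 2 * b 1) * F 0 1 * E 1 3 = 0 := by
      linear_combination -(h3 - 3 * h1 - h2) / 6
    simpa [hab 1 2 (by decide), hF01] using this
  simp only [h02, h03, h12, h13] at H
  have h23 : E 2 3 = 0 := by
    have h1 := H ![1, 0, 0, 1]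
    have h2 := H ![1, 0, 0, -1]
    simp at h1 h2
    have : (a 0 * b 3 - a 3 * b 0) * F 0 1 * E 2 3 = 0 := by
      linear_combination -(h1 + h2) / 2
    simpa [hab 0 3 (by decide), hF01] using this
  simp only [h23] at H
  have m0 : a 0 * (b 2 * E 3 3 - b 3 * E 2 2) - b 0 * (a 2 * E 3 3 - a 3 * E 2 2) +
      E 0 0 * (a 2 * b 3 - a 3 * b 2) = 0 := by
    have h1 := H ![1, 0, 1, 1]
    have h2 := H ![1, 0, -1, -1]
    simp [-mul_eq_zero, -neg_eq_zero] at h1 h2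
    refine (mul_eq_zero.mp ?_).resolve_left hF01
    linear_combination (h1 + h2) / 2
  have m1 : a 1 * (b 2 * E 3 3 - b 3 * E 2 2) - b 1 * (a 2 * E 3 3 - a 3 * E 2 2) +
      E 1 1 * (a 2 * b 3 - a 3 * b 2) = 0 := by
    have h1 := H ![0, 1, 1, 1]
    have h2 := H ![0, 1, -1, -1]
    simp [-mul_eq_zero, -neg_eq_zero] at h1 h2
    refine (mul_eq_zero.mp ?_).resolve_left hF01
    linear_combination -(h1 + h2) / 2
  have hd := hab 2 3 (by decide)
  refine ⟨(E 2 2 * b 3 - E 3 3 * b 2) / (a 2 * b 3 - a 3 * b 2),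
    (a 2 * E 3 3 - a 3 * E 2 2) / (a 2 * b 3 - a 3 * b 2), ?_⟩
  ext i j
  fin_cases i <;> fin_cases j <;>
    simp [sE 1 0, sE 2 0, sE 3 0, sE 2 1, sE 3 1, sE 3 2, hE01, h02, h03, h12, h13, h23] <;>
    rw [div_mul_eq_mul_div, div_mul_eq_mul_div, ← add_div, eq_div_iff hd]
  · linear_combination m0
  · linear_combination m1
  · ring
  · ring

theorem exists_relation_of_pencilDet_eq_zero {k : Type*} [Field k] [CharZero k]
    {a b : Fin 4 → k} (hab : ∀ i j, i ≠ j → a i * b j - a j * b i ≠ 0)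
    {C D : Matrix (Fin 4) (Fin 4) k} (hC : C.IsSymm) (hD : D.IsSymm)
    (H : ∀ w, pencilDet a b C D w = 0) :
    ∃ c : Fin 4 → k, c ≠ 0 ∧
      c 0 • Matrix.diagonal a + c 1 • Matrix.diagonal b + c 2 • C + c 3 • D = 0 := by
  by_cases hoff : ∀ i j, i ≠ j → C i j = 0 ∧ D i j = 0
  · have h1 := H 1
    obtain ⟨c, hc, h⟩ := Matrix.exists_mulVec_eq_zero_iff.mpr h1
    refine ⟨c, hc, ?_⟩
    have key : ∀ M : Matrix (Fin 4) (Fin 4) k, (∀ i j, i ≠ j → M i j = 0) →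
        ∀ i, M.mulVec 1 i = M i i := by
      intro M hM i
      rw [Matrix.mulVec, dotProduct, Finset.sum_eq_single i] <;> simp
      exact fun j hj => hM i j (Ne.symm hj)
    ext i j
    by_cases hij : i = j
    · subst hij
      have := congrFun h i
      rw [Matrix.mulVec, dotProduct, Fin.sum_univ_four] at this
      simp [key C fun i j h => (hoff i j h).1, key D fun i j h => (hoff i j h).2] at this
      simp
      linear_combination this
    · simp [hij, hoff i j hij]
  · push Not at hoff
    obtain ⟨i, j, hij, hne⟩ := hoff
    obtain ⟨σ, rfl, rfl⟩ : ∃ σ : Equiv.Perm (Fin 4), σ 0 = i ∧ σ 1 = j := by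
      clear hne
      revert i j
      decide
    obtain ⟨s, t, hst⟩ : ∃ s t : k, s * C (σ 0) (σ 1) + t * D (σ 0) (σ 1) ≠ 0 := by
      by_cases h0 : C (σ 0) (σ 1) = 0
      · exact ⟨0, 1, by simpa using hne h0⟩
      · exact ⟨1, 0, by simpa using h0⟩
    set x := C (σ 0) (σ 1) with hx
    set y := D (σ 0) (σ 1) with hy
    obtain ⟨α, β, h⟩ := eq_diagonal_of_pencilDet_eq_zero (a := a ∘ σ) (b := b ∘ σ)
      (E := (y • C + (-x) • D).submatrix σ σ) (F := (s • C + t • D).submatrix σ σ)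
      (fun i j hij => hab _ _ (σ.injective.ne hij))
      (((hC.smul y).add (hD.smul (-x))).submatrix σ) (((hC.smul s).add (hD.smul t)).submatrix σ)
      (fun w => by
        have := pencilDet_submatrix a b (y • C + (-x) • D) (s • C + t • D) σ (w ∘ σ.symm)
        rw [pencilDet_smul_add, H] at this
        simpa [Function.comp_assoc] using this)
      (by simp [← hx, ← hy]; ring) (by simpa [← hx, ← hy] using hst)
    refine ⟨![-α, -β, y, -x], ?_, ?_⟩
    · intro h0
      have h2 := congrFun h0 2
      have h3 := congrFun h0 3
      simp at h2 h3
      simp [h2, h3] at hst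
    · ext p q
      have := congrFun (congrFun h (σ.symm p)) (σ.symm q)
      simp [Matrix.diagonal_apply] at this ⊢
      linear_combination this

/-- No nonzero common zero `v` of the quadratic forms of `A` and `B` has `A v` and `B v`
linearly dependent. -/
def IsSmoothPencil {k : Type*} [Field k] (A B : Matrix (Fin 4) (Fin 4) k) : Prop :=
  ∀ v : Fin 4 → k, v ≠ 0 → v ⬝ᵥ A.mulVec v = 0 → v ⬝ᵥ B.mulVec v = 0 →
    ∀ s t : k, s • A.mulVec v + t • B.mulVec v = 0 → s = 0 ∧ t = 0

theorem Matrix.IsSymm.dotProduct_mulVec_comm {k : Type*} [Field k] {n : Type*} [Fintype n]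
    {A : Matrix n n k} (hA : A.IsSymm) (u v : n → k) :
    u ⬝ᵥ A.mulVec v = v ⬝ᵥ A.mulVec u := by
  rw [Matrix.dotProduct_mulVec, ← Matrix.mulVec_transpose, hA.eq, dotProduct_comm]

open Polynomial in
theorem IsSmoothPencil.exists_det_ne_zero {k : Type*} [Field k] [Infinite k]
    {A B : Matrix (Fin 4) (Fin 4) k} (hA : A.IsSymm) (h : IsSmoothPencil A B) :
    ∃ t : k, (A + t • B).det ≠ 0 := by
  by_contra! hdet
  have hpoly : (A.map Polynomial.C + (Polynomial.X : k[X]) • B.map Polynomial.C).det = 0 := by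
    apply Polynomial.funext
    intro t
    rw [Polynomial.eval_zero, ← hdet t, ← Polynomial.coe_evalRingHom, RingHom.map_det]
    congr 1
    ext i j
    simp
    exact mul_comm _ _
  obtain ⟨v, hv, hAv⟩ := Matrix.exists_mulVec_eq_zero_iff.mpr hpoly
  let c : ℕ → Fin 4 → k := fun n i => (v i).coeff n
  have hc : ∃ n, c n ≠ 0 := by
    by_contra! hc
    exact hv (funext fun i => Polynomial.ext fun n => congrFun (hc n) i)
  classical
  have hm := Nat.find_spec hc
  have hmin : ∀ n, n < Nat.find hc → c n = 0 := fun n hn => not_not.mp (Nat.find_min hc hn)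
  set m := Nat.find hc
  have hcoeff : ∀ n, A.mulVec (c (n + 1)) + B.mulVec (c n) = 0 := by
    intro n
    ext i
    have := congrArg (fun p : k[X] => p.coeff (n + 1)) (congrFun hAv i)
    simpa [Matrix.mulVec, dotProduct, add_mul, Finset.sum_add_distrib, mul_assoc,
      Polynomial.finsetSum_coeff, c] using this
  have hzero : A.mulVec (c m) = 0 := by
    rcases hmm : m with _ | n
    · ext i
      have := congrArg (fun p : k[X] => p.coeff 0) (congrFun hAv i)
      simpa [Matrix.mulVec, dotProduct, add_mul, Finset.sum_add_distrib, mul_assoc,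
        Polynomial.finsetSum_coeff, c] using this
    · have := hcoeff n
      rwa [hmin n (by omega), Matrix.mulVec_zero, add_zero] at this
  have hB : c m ⬝ᵥ B.mulVec (c m) = 0 := by
    rw [eq_neg_of_add_eq_zero_right (hcoeff m), dotProduct_neg, hA.dotProduct_mulVec_comm, hzero,
      dotProduct_zero, neg_zero]
  exact one_ne_zero (h (c m) hm (by simp [hzero]) hB 1 0 (by simp [hzero])).1

theorem IsSmoothPencil.add_smul {k : Type*} [Field k] {A B : Matrix (Fin 4) (Fin 4) k}
    (h : IsSmoothPencil A B) (t : k) : IsSmoothPencil (A + t • B) B := by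
  intro v hv hA hB s r hsr
  rw [Matrix.add_mulVec, Matrix.smul_mulVec] at hA hsr
  rw [dotProduct_add, dotProduct_smul, hB, smul_zero, add_zero] at hA
  obtain ⟨rfl, hr⟩ := h v hv hA hB s (s * t + r) (by rw [← hsr]; module)
  simpa using hr

theorem IsSmoothPencil.dotProduct_ne_zero {k : Type*} [Field k]
    {N B : Matrix (Fin 4) (Fin 4) k} (h : IsSmoothPencil N B) {v : Fin 4 → k} (hv : v ≠ 0) {μ : k}
    (hμ : B.mulVec v = μ • N.mulVec v) : v ⬝ᵥ N.mulVec v ≠ 0 := by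
  intro h0
  exact one_ne_zero (h v hv h0 (by rw [hμ, dotProduct_smul, h0, smul_zero]) (-μ) 1
    (by rw [hμ]; module)).2

theorem IsSmoothPencil.exists_basis {k : Type*} [Field k] [IsAlgClosed k]
    {N B : Matrix (Fin 4) (Fin 4) k} (hN : N.IsSymm) (hB : B.IsSymm) (h : IsSmoothPencil N B)
    (hdet : N.det ≠ 0) :
    ∃ (e : Module.Basis (Fin 4) k (Fin 4 → k)) (μ : Fin 4 → k),
      ∀ i, B.mulVec (e i) = μ i • N.mulVec (e i) := by
  classical
  let f : Module.End k (Fin 4 → k) := Matrix.toLin' (N⁻¹ * B)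
  have hf : ∀ v, N.mulVec (f v) = B.mulVec v := by
    intro v
    rw [Matrix.toLin'_apply, Matrix.mulVec_mulVec, Matrix.mul_nonsing_inv_cancel_left]
    exact hdet.isUnit
  have hker : ∀ (μ : k) (v : Fin 4 → k), (f - algebraMap k _ μ) ((f - algebraMap k _ μ) v) = 0 →
      (f - algebraMap k _ μ) v = 0 := by
    intro μ w hw
    by_contra hv
    set v := (f - algebraMap k _ μ) w with hvdef
    have hBv : B.mulVec v = μ • N.mulVec v := by
      rw [← hf, ← Matrix.mulVec_smul]
      congr 1
      simpa [sub_eq_zero, Module.algebraMap_end_apply] using hw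
    refine h.dotProduct_ne_zero hv hBv ?_
    have hNv : N.mulVec v = B.mulVec w - μ • N.mulVec w := by
      rw [hvdef, LinearMap.sub_apply, Matrix.mulVec_sub, hf, Module.algebraMap_end_apply,
        Matrix.mulVec_smul]
    rw [hNv, dotProduct_sub, dotProduct_smul, hB.dotProduct_mulVec_comm,
      hN.dotProduct_mulVec_comm, hBv, dotProduct_smul, sub_self]
  have hker' : ∀ (μ : k) (n : ℕ) (v : Fin 4 → k), ((f - algebraMap k _ μ) ^ n) v = 0 →
      (f - algebraMap k _ μ) v = 0 := by
    intro μ n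
    induction n with
    | zero => intro v hv; rw [pow_zero, Module.End.one_apply] at hv; rw [hv, map_zero]
    | succ n ih =>
      intro v hv
      rw [pow_succ, Module.End.mul_apply] at hv
      exact hker μ v (ih _ hv)
  have htop : ⨆ μ, f.eigenspace μ = ⊤ := by
    rw [eq_top_iff, ← Module.End.iSup_maxGenEigenspace_eq_top f]
    refine iSup_mono fun μ v hv => ?_
    obtain ⟨n, hn⟩ := (Module.End.mem_maxGenEigenspace f μ v).mp hv
    have := hker' μ n v (by simpa [Algebra.algebraMap_eq_smul_one] using hn)
    rw [Module.End.mem_eigenspace_iff]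
    simpa [sub_eq_zero, Module.algebraMap_end_apply] using this
  have hI := DirectSum.isInternal_submodule_of_iSupIndep_of_iSup_eq_top
    (Module.End.eigenspaces_iSupIndep f) htop
  let b := hI.collectedBasis fun μ => Module.Basis.ofVectorSpace k (f.eigenspace μ)
  let φ := b.indexEquiv (Pi.basisFun k (Fin 4))
  refine ⟨b.reindex φ, fun i => (φ.symm i).1, fun i => ?_⟩
  rw [Module.Basis.reindex_apply, ← hf, ← Matrix.mulVec_smul]
  congr 1
  exact Module.End.mem_eigenspace_iff.mp (hI.collectedBasis_mem _ _)

theorem IsSmoothPencil.eigenvalue_ne {k : Type*} [Field k] [IsAlgClosed k]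
    {N B : Matrix (Fin 4) (Fin 4) k} (hN : N.IsSymm) (h : IsSmoothPencil N B)
    {u v : Fin 4 → k} (huv : LinearIndependent k ![u, v]) {μ ν : k}
    (hu : B.mulVec u = μ • N.mulVec u) (hv : B.mulVec v = ν • N.mulVec v) : μ ≠ ν := by
  rintro rfl
  have hu0 : u ≠ 0 := huv.ne_zero 0
  have hn := h.dotProduct_ne_zero hu0 hu
  set n := u ⬝ᵥ N.mulVec u with hndef
  set m := u ⬝ᵥ N.mulVec v with hmdef
  obtain ⟨r, hr⟩ := IsAlgClosed.exists_pow_nat_eq (m ^ 2 - n * (v ⬝ᵥ N.mulVec v)) two_pos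
  have hx0 : (r - m) • u + n • v ≠ 0 := fun h0 =>
    hn (LinearIndependent.pair_iff.mp huv _ _ h0).2
  refine h.dotProduct_ne_zero (μ := μ) hx0 ?_ ?_
  · simp only [Matrix.mulVec_add, Matrix.mulVec_smul, hu, hv]
    module
  · simp only [Matrix.mulVec_add, Matrix.mulVec_smul, dotProduct_add, add_dotProduct,
      dotProduct_smul, smul_dotProduct, smul_eq_mul, hN.dotProduct_mulVec_comm v u, ← hndef,
      ← hmdef]
    linear_combination n * hr

theorem IsSmoothPencil.exists_diagonal {k : Type*} [Field k] [IsAlgClosed k]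
    {A B : Matrix (Fin 4) (Fin 4) k} (hA : A.IsSymm) (hB : B.IsSymm) (h : IsSmoothPencil A B) :
    ∃ (P : Matrix (Fin 4) (Fin 4) k) (a b : Fin 4 → k), IsUnit P ∧
      P.transpose * A * P = Matrix.diagonal a ∧ P.transpose * B * P = Matrix.diagonal b ∧
      ∀ i j, i ≠ j → a i * b j - a j * b i ≠ 0 := by
  obtain ⟨t, ht⟩ := h.exists_det_ne_zero hA
  set N := A + t • B with hNdef
  have hN : N.IsSymm := hA.add (hB.smul t)
  have hs : IsSmoothPencil N B := h.add_smul t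
  obtain ⟨e, μ, he⟩ := hs.exists_basis hN hB ht
  have hμ : ∀ i j, i ≠ j → μ i ≠ μ j := by
    intro i j hij
    refine hs.eigenvalue_ne hN ?_ (he i) (he j)
    convert e.linearIndependent.comp ![i, j] (by simpa [Function.Injective, Fin.forall_fin_two,
      eq_comm] using hij) using 1
    ext1 l
    fin_cases l <;> rfl
  let P : Matrix (Fin 4) (Fin 4) k := Matrix.of fun r i => e i r
  have hP : ∀ (M : Matrix (Fin 4) (Fin 4) k) i j,
      (P.transpose * M * P) i j = e i ⬝ᵥ M.mulVec (e j) := by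
    intro M i j
    rw [Matrix.mul_assoc, Matrix.mul_apply]
    rfl
  have hNe : ∀ i j, i ≠ j → e i ⬝ᵥ N.mulVec (e j) = 0 := by
    intro i j hij
    have h1 := hB.dotProduct_mulVec_comm (e i) (e j)
    rw [he, he, dotProduct_smul, dotProduct_smul, hN.dotProduct_mulVec_comm (e j), smul_eq_mul,
      smul_eq_mul, ← sub_eq_zero, ← sub_mul] at h1
    exact (mul_eq_zero.mp h1).resolve_left (sub_ne_zero.mpr (hμ j i hij.symm))
  have hBd : P.transpose * B * P =
      Matrix.diagonal fun i => μ i * (e i ⬝ᵥ N.mulVec (e i)) := by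
    ext i j
    rw [hP, he, dotProduct_smul, smul_eq_mul, Matrix.diagonal_apply]
    split_ifs with hij
    · rw [hij]
    · rw [hNe i j hij, mul_zero]
  have hNd : P.transpose * N * P = Matrix.diagonal fun i => e i ⬝ᵥ N.mulVec (e i) := by
    ext i j
    rw [hP, Matrix.diagonal_apply]
    split_ifs with hij
    · rw [hij]
    · exact hNe i j hij
  refine ⟨P, fun i => (1 - t * μ i) * (e i ⬝ᵥ N.mulVec (e i)),
    fun i => μ i * (e i ⬝ᵥ N.mulVec (e i)), ?_, ?_, hBd, ?_⟩
  · rw [← Matrix.linearIndependent_cols_iff_isUnit]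
    exact e.linearIndependent
  · have : A = N - t • B := by rw [hNdef, add_sub_cancel_right]
    rw [this, Matrix.mul_sub, Matrix.sub_mul, hNd, Matrix.mul_smul, Matrix.smul_mul, hBd]
    ext i j
    by_cases hij : i = j
    · subst hij
      simp
      ring
    · simp [hij]
  · intro i j hij
    have hn := fun i => hs.dotProduct_ne_zero (e.ne_zero i) (he i)
    have : (e i ⬝ᵥ N.mulVec (e i)) * (e j ⬝ᵥ N.mulVec (e j)) * (μ j - μ i) ≠ 0 :=
      mul_ne_zero (mul_ne_zero (hn i) (hn j)) (sub_ne_zero.mpr (hμ j i hij.symm))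
    convert this using 1
    ring

/-- The symmetric matrix of second derivatives of a quadratic form. -/
def hessianMatrix {k : Type*} [Field k] (Q : MvPolynomial (Fin 4) k) :
    Matrix (Fin 4) (Fin 4) k :=
  Matrix.of fun i j => coeff 0 (pderiv j (pderiv i Q))

theorem hessianMatrix_isSymm {k : Type*} [Field k] (Q : MvPolynomial (Fin 4) k) :
    (hessianMatrix Q).IsSymm := by
  ext i j
  simp only [hessianMatrix, Matrix.transpose_apply, Matrix.of_apply, pderiv_pderiv_comm i j]

theorem pderiv_eq_sum_hessianMatrix {k : Type*} [Field k] {Q : MvPolynomial (Fin 4) k}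
    (hQ : Q.IsHomogeneous 2) (i : Fin 4) :
    pderiv i Q = ∑ j, X j * C (hessianMatrix Q i j) := by
  have h1 : (pderiv i Q).IsHomogeneous 1 := hQ.pderiv
  have h := h1.sum_X_mul_pderiv
  rw [one_smul] at h
  refine h.symm.trans (Finset.sum_congr rfl fun j _ => ?_)
  rw [hessianMatrix, Matrix.of_apply]
  congr 1
  exact totalDegree_eq_zero_iff_eq_C.mp
    ((totalDegree_zero_iff_isHomogeneous _).mpr h1.pderiv)

theorem gradEval_eq_mulVec {k : Type*} [Field k] {Q : MvPolynomial (Fin 4) k}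
    (hQ : Q.IsHomogeneous 2) (v : Fin 4 → k) : gradEval Q v = (hessianMatrix Q).mulVec v := by
  ext i
  simp [gradEval, pderiv_eq_sum_hessianMatrix hQ, Matrix.mulVec, dotProduct, mul_comm]

theorem dotProduct_hessianMatrix {k : Type*} [Field k] {Q : MvPolynomial (Fin 4) k}
    (hQ : Q.IsHomogeneous 2) (v : Fin 4 → k) :
    v ⬝ᵥ (hessianMatrix Q).mulVec v = 2 * eval v Q := by
  have h := congrArg (eval v) hQ.sum_X_mul_pderiv
  simpa [← gradEval_eq_mulVec hQ, dotProduct, gradEval] using h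

theorem CutsOutEllipticCurve.isSmoothPencil {k : Type*} [Field k] [CharZero k]
    {P Q : MvPolynomial (Fin 4) k} (hP : P.IsHomogeneous 2) (hQ : Q.IsHomogeneous 2)
    (h : CutsOutEllipticCurve P Q) : IsSmoothPencil (hessianMatrix P) (hessianMatrix Q) := by
  intro v hv h1 h2
  rw [dotProduct_hessianMatrix ‹_›] at h1 h2
  have := h v hv (by simpa using h1) (by simpa using h2)
  rwa [gradEval_eq_mulVec hP, gradEval_eq_mulVec hQ, LinearIndependent.pair_iff] at this

theorem not_linearIndependent_of_hessianMatrix {k : Type*} [Field k] [CharZero k]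
    {Q : Fin 4 → MvPolynomial (Fin 4) k} (hQ : ∀ l, (Q l).IsHomogeneous 2) {c : Fin 4 → k}
    (hc : c ≠ 0) (h : ∑ l, c l • hessianMatrix (Q l) = 0) : ¬ LinearIndependent k Q := by
  rw [Fintype.not_linearIndependent_iff]
  refine ⟨c, ?_, Function.ne_iff.mp hc⟩
  have hhom : (∑ l, c l • Q l).IsHomogeneous 2 := IsHomogeneous.sum _ _ _ fun l _ => by
    rw [smul_eq_C_mul]
    simpa using (isHomogeneous_C (Fin 4) (c l)).mul (hQ l)
  have hhess : hessianMatrix (∑ l, c l • Q l) = 0 := by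
    rw [← h]
    ext i j
    simp [hessianMatrix, Matrix.sum_apply, coeff_sum]
  have he := hhom.sum_X_mul_pderiv
  simp only [pderiv_eq_sum_hessianMatrix hhom, hhess] at he
  simpa using he.symm

theorem not_linearIndependent_of_jacBracket_eq_zero {k : Type*} [Field k] [IsAlgClosed k]
    [CharZero k] {P Q R S : MvPolynomial (Fin 4) k}
    (hP : P.IsHomogeneous 2) (hQ : Q.IsHomogeneous 2)
    (hR : R.IsHomogeneous 2) (hS : S.IsHomogeneous 2) (hE : CutsOutEllipticCurve P Q)
    (h : jacBracket P Q R S = 0) : ¬ LinearIndependent k ![P, Q, R, S] := by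
  obtain ⟨T, a, b, hT, ha, hb, hab⟩ := (hE.isSmoothPencil hP hQ).exists_diagonal
    (hessianMatrix_isSymm P) (hessianMatrix_isSymm Q)
  have hsymm : ∀ F : MvPolynomial (Fin 4) k,
      (T.transpose * hessianMatrix F * T).IsSymm := by
    intro F
    rw [Matrix.IsSymm, Matrix.transpose_mul, Matrix.transpose_mul, Matrix.transpose_transpose,
      (hessianMatrix_isSymm F).eq, Matrix.mul_assoc]
  have hdet : ∀ w, pencilDet a b (T.transpose * hessianMatrix R * T)
      (T.transpose * hessianMatrix S * T) w = 0 := by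
    intro w
    have h0 := congrArg (eval (T.mulVec w)) h
    rw [jacBracket, map_zero, RingHom.map_det] at h0
    have hcol : ∀ F : MvPolynomial (Fin 4) k, F.IsHomogeneous 2 → ∀ r,
        (T.transpose * hessianMatrix F * T).mulVec w r =
          ∑ i, T.transpose r i * eval (T.mulVec w) (pderiv i F) := by
      intro F hF r
      rw [← Matrix.mulVec_mulVec, ← Matrix.mulVec_mulVec, ← gradEval_eq_mulVec hF]
      rfl
    have hda : ∀ r, a r * w r = (T.transpose * hessianMatrix P * T).mulVec w r := fun r => by
      rw [ha, Matrix.mulVec_diagonal]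
    have hdb : ∀ r, b r * w r = (T.transpose * hessianMatrix Q * T).mulVec w r := fun r => by
      rw [hb, Matrix.mulVec_diagonal]
    have hM : (Matrix.of fun r c => ![a r * w r, b r * w r,
        ((T.transpose * hessianMatrix R * T).mulVec w) r,
        ((T.transpose * hessianMatrix S * T).mulVec w) r] c) =
        T.transpose * (((eval (T.mulVec w)).mapMatrix
          (Matrix.of fun i j => pderiv i (![R, S, P, Q] j))).submatrix id
            (Equiv.addRight (2 : Fin 4))) := by
      ext r c
      rw [Matrix.mul_apply]
      fin_cases c
      · simpa using (hda r).trans (hcol P hP r)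
      · simpa using (hdb r).trans (hcol Q hQ r)
      · simpa using hcol R hR r
      · simpa using hcol S hS r
    rw [pencilDet, hM, Matrix.det_mul, Matrix.det_permute', h0, mul_zero, mul_zero]
  obtain ⟨c, hc, hrel⟩ := exists_relation_of_pencilDet_eq_zero hab (hsymm R) (hsymm S) hdet
  refine not_linearIndependent_of_hessianMatrix (fun l => ?_) hc ?_
  · fin_cases l <;> assumption
  · rw [← ha, ← hb] at hrel
    have hrel' : T.transpose * (∑ l, c l • hessianMatrix (![P, Q, R, S] l)) * T = 0 := by
      rw [← hrel, Fin.sum_univ_four]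
      simp [Matrix.mul_add, Matrix.add_mul]
    rwa [hT.mul_left_eq_zero, (Matrix.isUnit_transpose T |>.mpr hT).mul_right_eq_zero] at hrel'

/-- Theorem A (case of two curves): the Feigin–Odesskii brackets of two normal elliptic
curves in `P³` are compatible iff the two pencils of quadrics intersect nontrivially,
i.e. iff `Q₁, Q₂, Q₃, Q₄` are linearly dependent. -/
theorem theoremA_two_curves {k : Type*} [Field k] [IsAlgClosed k] [CharZero k]
    (Q₁ Q₂ Q₃ Q₄ : MvPolynomial (Fin 4) k)
    (h₁ : Q₁.IsHomogeneous 2) (h₂ : Q₂.IsHomogeneous 2)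
    (h₃ : Q₃.IsHomogeneous 2) (h₄ : Q₄.IsHomogeneous 2)
    (hE₁ : CutsOutEllipticCurve Q₁ Q₂) (hE₂ : CutsOutEllipticCurve Q₃ Q₄) :
    (∀ f g h : MvPolynomial (Fin 4) k,
        mixedJacobiator (jacBracket Q₁ Q₂) (jacBracket Q₃ Q₄) f g h = 0) ↔
      ¬ LinearIndependent k ![Q₁, Q₂, Q₃, Q₄] := by
  rw [mixedJacobiator_jacBracket_eq_zero_iff h₁ h₂ h₃ h₄]
  exact ⟨not_linearIndependent_of_jacBracket_eq_zero h₁ h₂ h₃ h₄ hE₁,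
    jacBracket_eq_zero_of_not_linearIndependent⟩
end
end

section
/- Theorem D (coordinate form). Let k be a field of characteristic zero and let Q₁,Q₂,Q₃,Q₄ ∈ k[x₁,x₂,x₃,x₄] be homogeneous quadratic forms. Let F = F_{Q₁,Q₂,Q₃,Q₄} be the associated quartic Jacobian determinant. Then for all f,g,h ∈ k[x₁,…,x₄], the mixed Jacobiator of the brackets {·,·}₁ := {·,·}_{Q₁,Q₂} and {·,·}₂ := {·,·}_{Q₃,Q₄} satisfies J(f,g,h) = det(∇F, ∇f, ∇g, ∇h), the determinant of the 4×4 matrix with columns ∇F, ∇f, ∇g, ∇h in this order. (This is the explicit form of the identity [Π_{Q₁=Q₂=0}, Π_{Q₃=Q₄=0}] = 4·Φ(Q₁∧Q₂∧Q₃∧Q₄) of Theorem D.) -/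
open MvPolynomial

noncomputable section

/-- The quartic Jacobian determinant `F_{Q₁,Q₂,Q₃,Q₄}`, whose value at `v` is
`det(∇Q₁(v), ∇Q₂(v), ∇Q₃(v), ∇Q₄(v))`. -/
def quarticJacDet {k : Type*} [Field k] (Q₁ Q₂ Q₃ Q₄ : MvPolynomial (Fin 4) k) :
    MvPolynomial (Fin 4) k :=
  Matrix.det (Matrix.of fun i j => pderiv i (![Q₁, Q₂, Q₃, Q₄] j))

section
variable {R : Type*} [CommRing R]

/-- The determinant of the 4×4 matrix with columns `a, b, c, d`. -/
def colDet (a b c d : Fin 4 → R) : R :=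
  Matrix.det (Matrix.of fun i j => ![a, b, c, d] j i)

lemma colDet_eq (a b c d : Fin 4 → R) : colDet a b c d =
    (a 0 * b 1 - a 1 * b 0) * (c 2 * d 3 - c 3 * d 2)
    - (a 0 * b 2 - a 2 * b 0) * (c 1 * d 3 - c 3 * d 1)
    + (a 0 * b 3 - a 3 * b 0) * (c 1 * d 2 - c 2 * d 1)
    + (a 1 * b 2 - a 2 * b 1) * (c 0 * d 3 - c 3 * d 0)
    - (a 1 * b 3 - a 3 * b 1) * (c 0 * d 2 - c 2 * d 0)
    + (a 2 * b 3 - a 3 * b 2) * (c 0 * d 1 - c 1 * d 0) := by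
  simp [colDet, Matrix.det_succ_row_zero, Fin.sum_univ_succ, Fin.succAbove]
  ring

/-- The derivative of `colDet a b c d` when `a, b, c, d` have derivatives
`A i, B i, C i, D i` in the direction `i`. -/
def colDetDeriv (a b c d : Fin 4 → R) (A B C D : Fin 4 → Fin 4 → R) : Fin 4 → R :=
  fun i => colDet (A i) b c d + colDet a (B i) c d + colDet a b (C i) d + colDet a b c (D i)

lemma colDet_swap_left (a b c d : Fin 4 → R) : colDet a b c d = -colDet b a c d := by
  simp only [colDet_eq]
  ring

lemma colDet_swap_right (a b c d : Fin 4 → R) : colDet a b c d = -colDet a b d c := by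
  simp only [colDet_eq]
  ring

lemma colDet_swap_pairs (a b c d : Fin 4 → R) : colDet a b c d = colDet c d a b := by
  simp only [colDet_eq]
  ring

lemma colDet_neg_left (a b c d : Fin 4 → R) :
    colDet (fun i => -a i) b c d = -colDet a b c d := by
  simp only [colDet_eq]
  ring

lemma colDet_colDetDeriv (a b c d e f g : Fin 4 → R) (A B C D : Fin 4 → Fin 4 → R) :
    colDet (colDetDeriv a b c d A B C D) e f g =
      colDet (fun i => colDet (A i) b c d) e f g + colDet (fun i => colDet a (B i) c d) e f g
      + colDet (fun i => colDet a b (C i) d) e f g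
      + colDet (fun i => colDet a b c (D i)) e f g := by
  simp only [colDet_eq _ e f g, colDetDeriv]
  ring

/-- A Hessian `H` in the first slot can be exchanged with the outer determinant: both sides are
`H(v, w)` for the vectors `v, w` dual to `a ∧ b ∧ c` and `d ∧ e ∧ f`. -/
lemma colDet_hessian_comm (a b c d e f : Fin 4 → R) (H : Fin 4 → Fin 4 → R)
    (hH : ∀ i j, H i j = H j i) :
    colDet (fun i => colDet (H i) a b c) d e f = colDet (fun i => colDet (H i) d e f) a b c := by
  simp only [colDet_eq, hH 1 0, hH 2 0, hH 3 0, hH 2 1, hH 3 1, hH 3 2]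
  ring

lemma colDet_hessian_comm_neg (a b c d e f : Fin 4 → R) (H : Fin 4 → Fin 4 → R)
    (hH : ∀ i j, H i j = H j i) :
    colDet (fun i => colDet a (H i) b c) d e f
      = -colDet (fun i => colDet (H i) d e f) a b c := by
  simp only [colDet_swap_left a (H _), colDet_neg_left]
  rw [colDet_hessian_comm _ _ _ _ _ _ H hH]

/-- The Plücker relation for 4×4 determinants, polarized by a symmetric matrix `H`. -/
lemma colDet_hessian_plucker (f g h p q r : Fin 4 → R) (H : Fin 4 → Fin 4 → R)
    (hH : ∀ i j, H i j = H j i) :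
    colDet (fun i => colDet f g (H i) r) h p q + colDet (fun i => colDet g h (H i) r) f p q
      + colDet (fun i => colDet h f (H i) r) g p q
    = colDet (fun i => colDet (H i) r p q) f g h := by
  simp only [colDet_eq, hH 1 0, hH 2 0, hH 3 0, hH 2 1, hH 3 1, hH 3 2]
  generalize p 0 * q 1 - p 1 * q 0 = m01
  generalize p 0 * q 2 - p 2 * q 0 = m02
  generalize p 0 * q 3 - p 3 * q 0 = m03
  generalize p 1 * q 2 - p 2 * q 1 = m12
  generalize p 1 * q 3 - p 3 * q 1 = m13
  generalize p 2 * q 3 - p 3 * q 2 = m23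
  ring

lemma colDet_hessian_plucker_right (f g h p q r : Fin 4 → R) (H : Fin 4 → Fin 4 → R)
    (hH : ∀ i j, H i j = H j i) :
    colDet (fun i => colDet f g r (H i)) h p q + colDet (fun i => colDet g h r (H i)) f p q
      + colDet (fun i => colDet h f r (H i)) g p q
    = colDet (fun i => colDet r (H i) p q) f g h := by
  simp only [colDet_swap_right _ _ r (H _), colDet_swap_left r (H _), colDet_neg_left]
  linear_combination -colDet_hessian_plucker f g h p q r H hH

/-- The pointwise form of the mixed Jacobiator identity, for gradients `f, g, h, p, q, r, s` and
symmetric Hessians `A, B, C, P, Q, S, T`. -/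
lemma colDetDeriv_jacobiator (f g h p q r s : Fin 4 → R) (A B C P Q S T : Fin 4 → Fin 4 → R)
    (hA : ∀ i j, A i j = A j i) (hB : ∀ i j, B i j = B j i) (hC : ∀ i j, C i j = C j i)
    (hP : ∀ i j, P i j = P j i) (hQ : ∀ i j, Q i j = Q j i) (hS : ∀ i j, S i j = S j i)
    (hT : ∀ i j, T i j = T j i) :
    colDet (colDetDeriv f g p q A B P Q) h r s + colDet (colDetDeriv g h p q B C P Q) f r s
      + colDet (colDetDeriv h f p q C A P Q) g r s + colDet (colDetDeriv f g r s A B S T) h p q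
      + colDet (colDetDeriv g h r s B C S T) f p q + colDet (colDetDeriv h f r s C A S T) g p q
    = colDet (colDetDeriv p q r s P Q S T) f g h := by
  simp only [colDet_colDetDeriv]
  have hS' := colDet_hessian_plucker f g h p q s S hS
  have hT' := colDet_hessian_plucker_right f g h p q r T hT
  rw [funext fun i => colDet_swap_pairs (S i) s p q] at hS'
  rw [funext fun i => colDet_swap_pairs r (T i) p q] at hT'
  linear_combination hS' + hT'
    + colDet_hessian_plucker f g h r s q P hP + colDet_hessian_plucker_right f g h r s p Q hQ
    + colDet_hessian_comm_neg h p q g r s A hA + colDet_hessian_comm_neg h r s g p q A hA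
    + colDet_hessian_comm_neg f p q h r s B hB + colDet_hessian_comm_neg f r s h p q B hB
    + colDet_hessian_comm_neg g p q f r s C hC + colDet_hessian_comm_neg g r s f p q C hC

end

section
variable {k : Type*} [Field k]

/-- The gradient of a polynomial in four variables. -/
def grad (f : MvPolynomial (Fin 4) k) : Fin 4 → MvPolynomial (Fin 4) k :=
  fun i => pderiv i f

/-- The Hessian of a polynomial in four variables. -/
def hess (f : MvPolynomial (Fin 4) k) : Fin 4 → Fin 4 → MvPolynomial (Fin 4) k :=
  fun i j => pderiv i (pderiv j f)

lemma hess_symm (f : MvPolynomial (Fin 4) k) (i j : Fin 4) : hess f i j = hess f j i := by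
  have hcomm : ⁅pderiv (R := k) i, pderiv (R := k) j⁆ = 0 := by
    apply derivation_ext
    intro l
    simp [Derivation.commutator_apply, pderiv_X, Pi.single_apply, apply_ite]
  rw [hess, hess, ← sub_eq_zero, ← Derivation.commutator_apply, hcomm, Derivation.zero_apply]

lemma det_pderiv_eq_colDet (a b c d : MvPolynomial (Fin 4) k) :
    Matrix.det (Matrix.of fun i j => pderiv i (![a, b, c, d] j)) =
      colDet (grad a) (grad b) (grad c) (grad d) := by
  unfold colDet
  congr 1
  apply Matrix.ext
  intro i j
  fin_cases j <;> rfl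

lemma grad_colDet_grad (a b c d : MvPolynomial (Fin 4) k) :
    grad (colDet (grad a) (grad b) (grad c) (grad d)) =
      colDetDeriv (grad a) (grad b) (grad c) (grad d) (hess a) (hess b) (hess c) (hess d) := by
  funext i
  simp only [colDetDeriv, colDet_eq, grad, hess, map_add, map_sub, Derivation.leibniz, smul_eq_mul]
  ring

end

/-- Theorem D (coordinate form): the mixed Jacobiator of the two Jacobian brackets
`{·,·}_{Q₁,Q₂}` and `{·,·}_{Q₃,Q₄}` equals `det(∇F, ∇f, ∇g, ∇h)` where
`F = F_{Q₁,Q₂,Q₃,Q₄}` is the quartic Jacobian determinant. -/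
theorem theoremD_coordinate_form {k : Type*} [Field k] [CharZero k]
    (Q₁ Q₂ Q₃ Q₄ : MvPolynomial (Fin 4) k)
    (h₁ : Q₁.IsHomogeneous 2) (h₂ : Q₂.IsHomogeneous 2)
    (h₃ : Q₃.IsHomogeneous 2) (h₄ : Q₄.IsHomogeneous 2) :
    ∀ f g h : MvPolynomial (Fin 4) k,
      mixedJacobiator (jacBracket Q₁ Q₂) (jacBracket Q₃ Q₄) f g h =
        Matrix.det (Matrix.of fun i j =>
          pderiv i (![quarticJacDet Q₁ Q₂ Q₃ Q₄, f, g, h] j)) := by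
  intro f g h
  simp only [mixedJacobiator, jacBracket, quarticJacDet, det_pderiv_eq_colDet, grad_colDet_grad]
  exact colDetDeriv_jacobiator _ _ _ _ _ _ _ _ _ _ _ _ _ _ (hess_symm f) (hess_symm g)
    (hess_symm h) (hess_symm Q₁) (hess_symm Q₂) (hess_symm Q₃) (hess_symm Q₄)
end
end

section
/- Let k be a field of characteristic zero and Q₁,Q₂,Q₃,Q₄ ∈ k[x₁,x₂,x₃,x₄] homogeneous quadratic forms. The Jacobian brackets {·,·}_{Q₁,Q₂} and {·,·}_{Q₃,Q₄} are compatible — i.e., their mixed Jacobiator J(f,g,h) vanishes for all f,g,h ∈ k[x₁,…,x₄] — if and only if the quartic Jacobian determinant F_{Q₁,Q₂,Q₃,Q₄} is the zero polynomial. -/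
open MvPolynomial

noncomputable section

/-- The Leibniz expansion of a 4×4 Jacobian determinant along the first two columns. -/
lemma jacBracket_eq {k : Type*} [Field k] (P Q f g : MvPolynomial (Fin 4) k) :
    jacBracket P Q f g =
      (pderiv 0 f * pderiv 1 g - pderiv 1 f * pderiv 0 g) *
          (pderiv 2 P * pderiv 3 Q - pderiv 3 P * pderiv 2 Q) -
        (pderiv 0 f * pderiv 2 g - pderiv 2 f * pderiv 0 g) *
          (pderiv 1 P * pderiv 3 Q - pderiv 3 P * pderiv 1 Q) +
        (pderiv 0 f * pderiv 3 g - pderiv 3 f * pderiv 0 g) *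
          (pderiv 1 P * pderiv 2 Q - pderiv 2 P * pderiv 1 Q) +
        (pderiv 1 f * pderiv 2 g - pderiv 2 f * pderiv 1 g) *
          (pderiv 0 P * pderiv 3 Q - pderiv 3 P * pderiv 0 Q) -
        (pderiv 1 f * pderiv 3 g - pderiv 3 f * pderiv 1 g) *
          (pderiv 0 P * pderiv 2 Q - pderiv 2 P * pderiv 0 Q) +
        (pderiv 2 f * pderiv 3 g - pderiv 3 f * pderiv 2 g) *
          (pderiv 0 P * pderiv 1 Q - pderiv 1 P * pderiv 0 Q) := by
  simp [jacBracket, Matrix.det_succ_row_zero, Fin.sum_univ_succ, Fin.succAbove]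
  ring

lemma jacBracket_mul_left {k : Type*} [Field k] (P Q f f' g : MvPolynomial (Fin 4) k) :
    jacBracket P Q (f * f') g = f * jacBracket P Q f' g + f' * jacBracket P Q f g := by
  simp only [jacBracket_eq, pderiv_mul]
  ring

lemma jacBracket_add_left {k : Type*} [Field k] (P Q f f' g : MvPolynomial (Fin 4) k) :
    jacBracket P Q (f + f') g = jacBracket P Q f g + jacBracket P Q f' g := by
  simp only [jacBracket_eq, map_add]
  ring

lemma jacBracket_C_left {k : Type*} [Field k] (P Q g : MvPolynomial (Fin 4) k) (a : k) :
    jacBracket P Q (C a) g = 0 := by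
  simp [jacBracket_eq]

lemma jacBracket_antisymm {k : Type*} [Field k] (P Q f g : MvPolynomial (Fin 4) k) :
    jacBracket P Q f g = -jacBracket P Q g f := by
  simp only [jacBracket_eq]
  ring

lemma jacBracket_self {k : Type*} [Field k] (P Q f : MvPolynomial (Fin 4) k) :
    jacBracket P Q f f = 0 := by
  simp only [jacBracket_eq]
  ring

lemma jacBracket_zero_left {k : Type*} [Field k] (P Q g : MvPolynomial (Fin 4) k) :
    jacBracket P Q 0 g = 0 := by
  simp [jacBracket_eq]

lemma jacBracket_neg_left {k : Type*} [Field k] (P Q f g : MvPolynomial (Fin 4) k) :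
    jacBracket P Q (-f) g = -jacBracket P Q f g := by
  simp only [jacBracket_eq, map_neg]
  ring

/-- Partial derivatives commute. -/
lemma pderiv_comm_apply {σ k : Type*} [CommRing k] (i j : σ) (p : MvPolynomial σ k) :
    pderiv i (pderiv j p) = pderiv j (pderiv i p) := by
  classical
  have h : ⁅(pderiv i : Derivation k (MvPolynomial σ k) (MvPolynomial σ k)),
      (pderiv j : Derivation k (MvPolynomial σ k) (MvPolynomial σ k))⁆ = 0 := by
    refine derivation_ext fun l => ?_
    simp [Derivation.commutator_apply, pderiv_X, Pi.single_apply, apply_ite]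
  simpa [Derivation.commutator_apply, sub_eq_zero] using DFunLike.congr_fun h p

/-- A ternary predicate stable under permutations that holds on increasing triples and on triples
with a repeated entry holds everywhere. -/
lemma forall_of_lt_of_rotate_of_swap {α : Type*} [LinearOrder α] {p : α → α → α → Prop}
    (rot : ∀ i j l, p i j l → p j l i) (swap : ∀ i j l, p i j l → p j i l)
    (self : ∀ i l, p i i l) (lt : ∀ i j l, i < j → j < l → p i j l) (i j l : α) : p i j l := by
  have key : ∀ i j l, i < j → p i j l := by
    intro i j l hij
    rcases lt_trichotomy j l with hjl | rfl | hlj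
    · exact lt i j l hij hjl
    · exact rot _ _ _ (rot _ _ _ (self j i))
    · rcases lt_trichotomy l i with hli | rfl | hil
      · exact rot _ _ _ (lt l i j hli hij)
      · exact rot _ _ _ (self l j)
      · exact rot _ _ _ (swap _ _ _ (lt i l j hil hlj))
  rcases lt_trichotomy i j with hij | rfl | hji
  · exact key i j l hij
  · exact self i l
  · exact swap _ _ _ (key j i l hji)

section Jacobiator

variable {k : Type*} [Field k] (P Q R S : MvPolynomial (Fin 4) k)

lemma mixedJacobiator_rotate (f g h : MvPolynomial (Fin 4) k) :
    mixedJacobiator (jacBracket P Q) (jacBracket R S) f g h =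
      mixedJacobiator (jacBracket P Q) (jacBracket R S) g h f := by
  simp only [mixedJacobiator]
  ring

lemma mixedJacobiator_swap (f g h : MvPolynomial (Fin 4) k) :
    mixedJacobiator (jacBracket P Q) (jacBracket R S) f g h =
      -mixedJacobiator (jacBracket P Q) (jacBracket R S) g f h := by
  simp only [mixedJacobiator]
  rw [jacBracket_antisymm P Q f g, jacBracket_antisymm P Q g h, jacBracket_antisymm P Q h f,
    jacBracket_antisymm R S f g, jacBracket_antisymm R S g h, jacBracket_antisymm R S h f]
  simp only [jacBracket_neg_left]
  ring

lemma mixedJacobiator_self (f h : MvPolynomial (Fin 4) k) :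
    mixedJacobiator (jacBracket P Q) (jacBracket R S) f f h = 0 := by
  simp only [mixedJacobiator]
  rw [jacBracket_antisymm P Q f h, jacBracket_antisymm R S f h]
  simp only [jacBracket_neg_left, jacBracket_self, jacBracket_zero_left]
  ring

lemma mixedJacobiator_add_left (f f' g h : MvPolynomial (Fin 4) k) :
    mixedJacobiator (jacBracket P Q) (jacBracket R S) (f + f') g h =
      mixedJacobiator (jacBracket P Q) (jacBracket R S) f g h +
        mixedJacobiator (jacBracket P Q) (jacBracket R S) f' g h := by
  simp only [mixedJacobiator]
  rw [jacBracket_antisymm P Q h, jacBracket_antisymm R S h,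
    jacBracket_antisymm P Q h f, jacBracket_antisymm R S h f,
    jacBracket_antisymm P Q h f', jacBracket_antisymm R S h f',
    jacBracket_antisymm P Q _ (f + f'), jacBracket_antisymm R S _ (f + f'),
    jacBracket_antisymm P Q _ f, jacBracket_antisymm R S _ f,
    jacBracket_antisymm P Q _ f', jacBracket_antisymm R S _ f']
  simp only [jacBracket_add_left, jacBracket_neg_left]
  ring

lemma mixedJacobiator_C_left (a : k) (g h : MvPolynomial (Fin 4) k) :
    mixedJacobiator (jacBracket P Q) (jacBracket R S) (C a) g h = 0 := by
  simp only [mixedJacobiator]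
  rw [jacBracket_antisymm P Q h, jacBracket_antisymm R S h,
    jacBracket_antisymm P Q _ (C a), jacBracket_antisymm R S _ (C a)]
  simp only [jacBracket_C_left, jacBracket_neg_left, jacBracket_zero_left]
  ring

/-- The mixed Jacobiator satisfies the Leibniz rule in its first argument. -/
lemma mixedJacobiator_mul_left (f f' g h : MvPolynomial (Fin 4) k) :
    mixedJacobiator (jacBracket P Q) (jacBracket R S) (f * f') g h =
      f * mixedJacobiator (jacBracket P Q) (jacBracket R S) f' g h +
        f' * mixedJacobiator (jacBracket P Q) (jacBracket R S) f g h := by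
  simp only [mixedJacobiator]
  rw [jacBracket_antisymm P Q h (f * f'), jacBracket_antisymm R S h (f * f'),
    jacBracket_antisymm P Q h f, jacBracket_antisymm R S h f,
    jacBracket_antisymm P Q h f', jacBracket_antisymm R S h f',
    jacBracket_antisymm P Q _ (f * f'), jacBracket_antisymm R S _ (f * f'),
    jacBracket_antisymm P Q (jacBracket R S g h) f, jacBracket_antisymm R S (jacBracket P Q g h) f,
    jacBracket_antisymm P Q (jacBracket R S g h) f',
    jacBracket_antisymm R S (jacBracket P Q g h) f']
  simp only [jacBracket_mul_left, jacBracket_add_left, jacBracket_neg_left]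
  ring

/-- The first argument of the mixed Jacobiator may be tested on coordinates only. -/
lemma mixedJacobiator_eq_zero_of_X {g h : MvPolynomial (Fin 4) k}
    (H : ∀ i, mixedJacobiator (jacBracket P Q) (jacBracket R S) (X i) g h = 0)
    (f : MvPolynomial (Fin 4) k) :
    mixedJacobiator (jacBracket P Q) (jacBracket R S) f g h = 0 := by
  induction f using MvPolynomial.induction_on with
  | C a => exact mixedJacobiator_C_left P Q R S a g h
  | add p q hp hq => rw [mixedJacobiator_add_left, hp, hq, add_zero]
  | mul_X p i hp => rw [mixedJacobiator_mul_left, hp, H, mul_zero, mul_zero, add_zero]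

lemma quarticJacDet_eq_jacBracket : quarticJacDet P Q R S = jacBracket R S P Q := rfl

lemma mixedJacobiator_X_012 :
    mixedJacobiator (jacBracket P Q) (jacBracket R S) (X 0) (X 1) (X 2) =
      -pderiv 3 (quarticJacDet P Q R S) := by
  simp [mixedJacobiator, quarticJacDet_eq_jacBracket, jacBracket_eq, pderiv_X,
    pderiv_comm_apply (1 : Fin 4) 0, pderiv_comm_apply (2 : Fin 4) 0,
    pderiv_comm_apply (3 : Fin 4) 0, pderiv_comm_apply (2 : Fin 4) 1,
    pderiv_comm_apply (3 : Fin 4) 1, pderiv_comm_apply (3 : Fin 4) 2]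
  ring

lemma mixedJacobiator_X_013 :
    mixedJacobiator (jacBracket P Q) (jacBracket R S) (X 0) (X 1) (X 3) =
      pderiv 2 (quarticJacDet P Q R S) := by
  simp [mixedJacobiator, quarticJacDet_eq_jacBracket, jacBracket_eq, pderiv_X,
    pderiv_comm_apply (1 : Fin 4) 0, pderiv_comm_apply (2 : Fin 4) 0,
    pderiv_comm_apply (3 : Fin 4) 0, pderiv_comm_apply (2 : Fin 4) 1,
    pderiv_comm_apply (3 : Fin 4) 1, pderiv_comm_apply (3 : Fin 4) 2]
  ring

lemma mixedJacobiator_X_023 :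
    mixedJacobiator (jacBracket P Q) (jacBracket R S) (X 0) (X 2) (X 3) =
      -pderiv 1 (quarticJacDet P Q R S) := by
  simp [mixedJacobiator, quarticJacDet_eq_jacBracket, jacBracket_eq, pderiv_X,
    pderiv_comm_apply (1 : Fin 4) 0, pderiv_comm_apply (2 : Fin 4) 0,
    pderiv_comm_apply (3 : Fin 4) 0, pderiv_comm_apply (2 : Fin 4) 1,
    pderiv_comm_apply (3 : Fin 4) 1, pderiv_comm_apply (3 : Fin 4) 2]
  ring

lemma mixedJacobiator_X_123 :
    mixedJacobiator (jacBracket P Q) (jacBracket R S) (X 1) (X 2) (X 3) =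
      pderiv 0 (quarticJacDet P Q R S) := by
  simp [mixedJacobiator, quarticJacDet_eq_jacBracket, jacBracket_eq, pderiv_X,
    pderiv_comm_apply (1 : Fin 4) 0, pderiv_comm_apply (2 : Fin 4) 0,
    pderiv_comm_apply (3 : Fin 4) 0, pderiv_comm_apply (2 : Fin 4) 1,
    pderiv_comm_apply (3 : Fin 4) 1, pderiv_comm_apply (3 : Fin 4) 2]
  ring

/-- If the Jacobian determinant vanishes, so does the mixed Jacobiator on coordinates. -/
lemma mixedJacobiator_X_eq_zero (hF : quarticJacDet P Q R S = 0) (i j l : Fin 4) :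
    mixedJacobiator (jacBracket P Q) (jacBracket R S) (X i) (X j) (X l) = 0 := by
  refine forall_of_lt_of_rotate_of_swap (p := fun i j l =>
    mixedJacobiator (jacBracket P Q) (jacBracket R S) (X i) (X j) (X l) = 0)
    (fun i j l h => (mixedJacobiator_rotate P Q R S _ _ _).symm.trans h)
    (fun i j l h => (mixedJacobiator_swap P Q R S _ _ _).trans (neg_eq_zero.mpr h))
    (fun i l => mixedJacobiator_self P Q R S _ _) (fun i j l hij hjl => ?_) i j l
  obtain ⟨rfl, rfl, rfl⟩ | ⟨rfl, rfl, rfl⟩ | ⟨rfl, rfl, rfl⟩ | ⟨rfl, rfl, rfl⟩ :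
      (i = 0 ∧ j = 1 ∧ l = 2) ∨ (i = 0 ∧ j = 1 ∧ l = 3) ∨
        (i = 0 ∧ j = 2 ∧ l = 3) ∨ (i = 1 ∧ j = 2 ∧ l = 3) := by lia
  · simp [mixedJacobiator_X_012, hF]
  · simp [mixedJacobiator_X_013, hF]
  · simp [mixedJacobiator_X_023, hF]
  · simp [mixedJacobiator_X_123, hF]

end Jacobiator

lemma quarticJacDet_isHomogeneous {k : Type*} [Field k] {P Q R S : MvPolynomial (Fin 4) k}
    (hP : P.IsHomogeneous 2) (hQ : Q.IsHomogeneous 2)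
    (hR : R.IsHomogeneous 2) (hS : S.IsHomogeneous 2) :
    (quarticJacDet P Q R S).IsHomogeneous 4 := by
  have h2 : ∀ {A B : MvPolynomial (Fin 4) k}, A.IsHomogeneous 2 → B.IsHomogeneous 2 →
      ∀ i j, (pderiv i A * pderiv j B - pderiv j A * pderiv i B).IsHomogeneous 2 :=
    fun hA hB i j => (hA.pderiv.mul hB.pderiv).sub (hA.pderiv.mul hB.pderiv)
  have h4 := fun i j l m => (h2 hP hQ i j).mul (h2 hR hS l m)
  rw [quarticJacDet_eq_jacBracket, jacBracket_eq]
  exact (((((h4 _ _ _ _).sub (h4 _ _ _ _)).add (h4 _ _ _ _)).add (h4 _ _ _ _)).sub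
    (h4 _ _ _ _)).add (h4 _ _ _ _)

/-- The Jacobian brackets `{·,·}_{Q₁,Q₂}` and `{·,·}_{Q₃,Q₄}` are compatible iff the
quartic Jacobian determinant `F_{Q₁,Q₂,Q₃,Q₄}` is the zero polynomial. -/
theorem compatible_iff_quartic_zero {k : Type*} [Field k] [CharZero k]
    (Q₁ Q₂ Q₃ Q₄ : MvPolynomial (Fin 4) k)
    (h₁ : Q₁.IsHomogeneous 2) (h₂ : Q₂.IsHomogeneous 2)
    (h₃ : Q₃.IsHomogeneous 2) (h₄ : Q₄.IsHomogeneous 2) :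
    (∀ f g h : MvPolynomial (Fin 4) k,
        mixedJacobiator (jacBracket Q₁ Q₂) (jacBracket Q₃ Q₄) f g h = 0) ↔
      quarticJacDet Q₁ Q₂ Q₃ Q₄ = 0 := by
  constructor
  · intro H
    have hd : ∀ i, pderiv i (quarticJacDet Q₁ Q₂ Q₃ Q₄) = 0 := by
      intro i
      fin_cases i
      · simpa [mixedJacobiator_X_123] using H (X 1) (X 2) (X 3)
      · simpa [mixedJacobiator_X_023] using H (X 0) (X 2) (X 3)
      · simpa [mixedJacobiator_X_013] using H (X 0) (X 1) (X 3)
      · simpa [mixedJacobiator_X_012] using H (X 0) (X 1) (X 2)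
    have euler := (quarticJacDet_isHomogeneous h₁ h₂ h₃ h₄).sum_X_mul_pderiv
    simpa [hd] using euler.symm
  · intro hF f g h
    refine mixedJacobiator_eq_zero_of_X _ _ _ _ (fun i => ?_) f
    rw [mixedJacobiator_rotate]
    refine mixedJacobiator_eq_zero_of_X _ _ _ _ (fun j => ?_) g
    rw [mixedJacobiator_rotate]
    refine mixedJacobiator_eq_zero_of_X _ _ _ _ (fun l => ?_) h
    rw [mixedJacobiator_rotate]
    exact mixedJacobiator_X_eq_zero _ _ _ _ hF i j l
end
end

section
/- Let k be an algebraically closed field of characteristic zero and let Q₁,Q₂,Q₃,Q₄ ∈ k[x₁,x₂,x₃,x₄] be homogeneous quadratic forms such that each of the pairs (Q₁,Q₂) and (Q₃,Q₄) cuts out a normal elliptic curve in P³. Then the quartic Jacobian determinant F_{Q₁,Q₂,Q₃,Q₄} is the zero polynomial if and only if Q₁,Q₂,Q₃,Q₄ are linearly dependent in the k-vector space of quadratic forms. -/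
open MvPolynomial

noncomputable section

section Univariate

open Polynomial (derivative)

variable {k : Type*} [Field k]

/-- Two polynomials with vanishing Wronskian are proportional. -/
lemma exists_eq_C_mul_of_derivative_mul_eq [CharZero k] {a b : Polynomial k} (hb : b ≠ 0)
    (h : derivative a * b = a * derivative b) : ∃ c : k, a = Polynomial.C c * b := by
  obtain ⟨g, a', b', hg, hcop, rfl, rfl⟩ : ∃ g a' b' : Polynomial k,
      g ≠ 0 ∧ IsCoprime a' b' ∧ a = g * a' ∧ b = g * b' := by
    classical
    let := EuclideanDomain.gcdMonoid (Polynomial k)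
    obtain ⟨a', b', ha, hb', hu⟩ := extract_gcd a b
    exact ⟨gcd a b, a', b', fun h0 => hb (by rw [hb', h0, zero_mul]),
      (gcd_isUnit_iff _ _).1 hu, ha, hb'⟩
  have hw : Polynomial.wronskian a' b' = 0 := by
    have : g ^ 2 * Polynomial.wronskian a' b' = 0 := by
      simp only [Polynomial.derivative_mul] at h
      rw [Polynomial.wronskian]
      linear_combination -h
    exact (mul_eq_zero.1 this).resolve_left (pow_ne_zero _ hg)
  obtain ⟨ha, hb'⟩ := hcop.wronskian_eq_zero_iff.1 hw
  have hbC := Polynomial.eq_C_of_derivative_eq_zero hb'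
  have hne : b'.coeff 0 ≠ 0 := fun h0 => hb (by rw [hbC, h0, Polynomial.C_0, mul_zero])
  refine ⟨a'.coeff 0 / b'.coeff 0, ?_⟩
  rw [Polynomial.eq_C_of_derivative_eq_zero ha, hbC, Polynomial.coeff_C_zero,
    Polynomial.coeff_C_zero, mul_left_comm, ← Polynomial.C_mul, div_mul_cancel₀ _ hne]

/-- A polynomial with a simple root is not, up to a constant, a quotient of squares. -/
lemma eq_zero_of_sq_mul_eq {q a b : Polynomial k} {c s : k} (hs : q.eval s = 0)
    (hs' : (derivative q).eval s ≠ 0) (h : a ^ 2 * q = Polynomial.C c * b ^ 2) : a = 0 := by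
  by_contra ha
  have hq : q ≠ 0 := by rintro rfl; simp at hs'
  have hl : a ^ 2 * q ≠ 0 := mul_ne_zero (pow_ne_zero _ ha) hq
  have hr : Polynomial.C c * b ^ 2 ≠ 0 := h ▸ hl
  have hqm : q.rootMultiplicity s = 1 := by
    have h1 : 0 < q.rootMultiplicity s := (Polynomial.rootMultiplicity_pos hq).2 hs
    have h2 : ¬ 1 < q.rootMultiplicity s := fun h2 =>
      hs' ((Polynomial.one_lt_rootMultiplicity_iff_isRoot hq).1 h2).2
    omega
  have hm := congrArg (Polynomial.rootMultiplicity s) h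
  rw [Polynomial.rootMultiplicity_mul hl, Polynomial.rootMultiplicity_mul hr, sq, sq,
    Polynomial.rootMultiplicity_mul (mul_ne_zero ha ha), Polynomial.rootMultiplicity_C, hqm,
    Polynomial.rootMultiplicity_mul (by
      rintro h0; exact hr (by rw [sq, h0, mul_zero]))] at hm
  omega

/-- On the double cover `w ^ 2 = q` branched at a simple root of `q`, two functions `P + w L` and
`M + w N` with vanishing Wronskian are proportional. The two hypotheses are the even and the odd
part of the Wronskian. -/
lemma exists_linear_relation_of_wronskian_double_cover [CharZero k] {q P L M N : Polynomial k} {s : k}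
    (hs : q.eval s = 0) (hs' : (derivative q).eval s ≠ 0)
    (heven : P * (2 * q * derivative N + derivative q * N) + 2 * q * L * derivative M
      - M * (2 * q * derivative L + derivative q * L) - 2 * q * N * derivative P = 0)
    (hodd : 2 * (P * derivative M - M * derivative P)
      + 2 * q * (L * derivative N - N * derivative L) = 0) :
    ∃ α β : k, (α ≠ 0 ∨ β ≠ 0) ∧ Polynomial.C α * P + Polynomial.C β * M = 0 ∧
      Polynomial.C α * L + Polynomial.C β * N = 0 := by
  by_cases hΔ : M ^ 2 - q * N ^ 2 = 0
  · have hN : N = 0 := eq_zero_of_sq_mul_eq (b := M) (c := 1) hs hs' (by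
      rw [Polynomial.C_1]; linear_combination -hΔ)
    have hM : M = 0 := by simpa [hN] using hΔ
    exact ⟨0, 1, Or.inr one_ne_zero, by simp [hM], by simp [hN]⟩
  have h2 : (2 : Polynomial k) ≠ 0 := two_ne_zero
  have hV : L * M - P * N = 0 := by
    obtain ⟨c, hc⟩ := exists_eq_C_mul_of_derivative_mul_eq
      (a := (L * M - P * N) ^ 2 * q) (pow_ne_zero 2 hΔ) (by
        simp only [Polynomial.derivative_mul, Polynomial.derivative_sub, Polynomial.derivative_sq,
          map_ofNat]
        linear_combination -(M ^ 2 - q * N ^ 2) * (L * M - P * N) *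
          ((M ^ 2 + q * N ^ 2) * heven - 2 * q * M * N * hodd))
    exact eq_zero_of_sq_mul_eq hs hs' hc
  obtain ⟨u, hu⟩ := exists_eq_C_mul_of_derivative_mul_eq
    (a := P * M - q * L * N) hΔ (by
      apply mul_left_cancel₀ h2
      simp only [Polynomial.derivative_mul, Polynomial.derivative_sub, Polynomial.derivative_sq,
        map_ofNat]
      linear_combination 2 * M * N * heven - (M ^ 2 + q * N ^ 2) * hodd)
  refine ⟨1, -u, Or.inl one_ne_zero, ?_, ?_⟩
  · refine (mul_eq_zero.1 (?_ : (M ^ 2 - q * N ^ 2) * _ = 0)).resolve_left hΔ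
    rw [Polynomial.C_1, Polynomial.C_neg]
    linear_combination M * hu + q * N * hV
  · refine (mul_eq_zero.1 (?_ : (M ^ 2 - q * N ^ 2) * _ = 0)).resolve_left hΔ
    rw [Polynomial.C_1, Polynomial.C_neg]
    linear_combination N * hu + M * hV

end Univariate

section BilinearForms

variable {k V : Type*} [Field k] [AddCommGroup V] [Module k V]

/-- Three linear forms on a four-dimensional space have a common nonzero zero. -/
lemma exists_ne_zero_of_three_forms (hV : Module.finrank k V = 4) (f g h : V →ₗ[k] k) :
    ∃ v : V, v ≠ 0 ∧ f v = 0 ∧ g v = 0 ∧ h v = 0 := by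
  have : FiniteDimensional k V := Module.finite_of_finrank_pos (by omega)
  have hker : LinearMap.ker (LinearMap.pi ![f, g, h]) ≠ ⊥ :=
    LinearMap.ker_ne_bot_of_finrank_lt (by simp [hV])
  obtain ⟨v, hv, hv0⟩ := Submodule.exists_mem_ne_zero_of_ne_bot hker
  have hz (i : Fin 3) : ![f, g, h] i v = 0 := congrFun (LinearMap.mem_ker.1 hv) i
  exact ⟨v, hv0, hz 0, hz 1, hz 2⟩

/-- If `y ≠ 0` is orthogonal to the anisotropic vector `x`, then `y + z x` is nonzero and isotropic
for some `z`. -/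
lemma exists_isotropic_add_smul [IsAlgClosed k] (B : LinearMap.BilinForm k V)
    (hB : ∀ x y, B x y = B y x) {x y : V} (hx : B x x ≠ 0) (hxy : B x y = 0) (hy : y ≠ 0) :
    ∃ z : k, y + z • x ≠ 0 ∧ B (y + z • x) (y + z • x) = 0 := by
  obtain ⟨z, hz⟩ := IsAlgClosed.exists_pow_nat_eq (-(B y y) / B x x) (n := 2) two_pos
  refine ⟨z, fun h0 => ?_, ?_⟩
  · have h1 := congrArg (B x) h0
    simp only [map_add, map_smul, map_zero, hxy, zero_add, smul_eq_mul, mul_eq_zero, hx,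
      or_false] at h1
    exact hy (by simpa [h1] using h0)
  · have hyx := hB y x
    simp only [map_add, map_smul, LinearMap.add_apply, LinearMap.smul_apply, smul_eq_mul, hyx, hxy]
    field_simp at hz
    linear_combination hz

/-- The pencil of symmetric bilinear forms spanned by `B` and `C` has a smooth base locus. -/
def SmoothPencil (B C : LinearMap.BilinForm k V) : Prop :=
  ∀ v : V, v ≠ 0 → B v v = 0 → C v v = 0 → ∀ a b : k, a • B v + b • C v = 0 → a = 0 ∧ b = 0

/-- A coordinate system in which `B` is the cone `2 (x₀ x₃ - x₂ ^ 2)` with vertex `e₁`, and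
`C` is `-x₁ ^ 2` plus a form in `x₀, x₂, x₃`. -/
structure ConeFrame (B C : LinearMap.BilinForm k V) where
  e₀ : V
  e₁ : V
  e₂ : V
  e₃ : V
  ext : ∀ f : V →ₗ[k] k, f e₀ = 0 → f e₁ = 0 → f e₂ = 0 → f e₃ = 0 → f = 0
  B_symm : ∀ x y, B x y = B y x
  C_symm : ∀ x y, C x y = C y x
  B₁ : B e₁ = 0
  B₀₀ : B e₀ e₀ = 0
  B₀₂ : B e₀ e₂ = 0
  B₀₃ : B e₀ e₃ = 1
  B₂₂ : B e₂ e₂ = -2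
  B₂₃ : B e₂ e₃ = 0
  B₃₃ : B e₃ e₃ = 0
  C₀₁ : C e₀ e₁ = 0
  C₁₁ : C e₁ e₁ = -1
  C₁₂ : C e₁ e₂ = 0
  C₁₃ : C e₁ e₃ = 0

lemma exists_smul_apply_self_eq [IsAlgClosed k] (C : LinearMap.BilinForm k V) {e : V}
    (he : C e e ≠ 0) {c : k} (hc : c ≠ 0) : ∃ z : k, z ≠ 0 ∧ C (z • e) (z • e) = c := by
  obtain ⟨z, hz⟩ := IsAlgClosed.exists_pow_nat_eq (c / C e e) (n := 2) two_pos
  refine ⟨z, ?_, ?_⟩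
  · rintro rfl
    exact div_ne_zero hc he (by rw [← hz]; simp)
  · simp only [map_smul, LinearMap.smul_apply, smul_eq_mul]
    field_simp at hz
    linear_combination hz

/-- A smooth pencil containing a degenerate form admits a cone frame. -/
lemma SmoothPencil.nonempty_coneFrame [IsAlgClosed k] [CharZero k]
    (hV : Module.finrank k V = 4) {B C : LinearMap.BilinForm k V} (hB : ∀ x y, B x y = B y x)
    (hC : ∀ x y, C x y = C y x) (hBC : SmoothPencil B C) {e : V} (he : e ≠ 0) (hBe : B e = 0) :
    Nonempty (ConeFrame B C) := by
  have hCe : C e e ≠ 0 := fun h0 => one_ne_zero (hBC e he (by simp [hBe]) h0 1 0 (by simp [hBe])).1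
  obtain ⟨z, hz0, hz⟩ := exists_smul_apply_self_eq C hCe (neg_ne_zero.2 (one_ne_zero (α := k)))
  obtain ⟨e₁, hB₁, hC₁⟩ : ∃ e₁, B e₁ = 0 ∧ C e₁ e₁ = -1 := ⟨z • e, by simp [hBe], hz⟩
  have hC₁0 : C e₁ e₁ ≠ 0 := by simp [hC₁]
  have hB₁' (x : V) : B x e₁ = 0 := by rw [hB, hB₁, LinearMap.zero_apply]
  have hnondeg (u : V) (hu : u ≠ 0) (hCu : C e₁ u = 0) : B u ≠ 0 := by
    intro hBu
    obtain ⟨z, h0, hz⟩ := exists_isotropic_add_smul C hC hC₁0 hCu hu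
    have hBv : B (u + z • e₁) = 0 := by simp [hBu, hB₁]
    exact one_ne_zero (hBC _ h0 (by simp [hBv]) hz 1 0 (by simp [hBv])).1
  obtain ⟨e₀, he₀, hC₀, hB₀⟩ : ∃ e₀ : V, e₀ ≠ 0 ∧ C e₁ e₀ = 0 ∧ B e₀ e₀ = 0 := by
    obtain ⟨u, hu, hCu, -⟩ := exists_ne_zero_of_three_forms hV (C e₁) 0 0
    by_cases hBu : B u u = 0
    · exact ⟨u, hu, hCu, hBu⟩
    obtain ⟨y, hy, hCy, hBy, -⟩ := exists_ne_zero_of_three_forms hV (C e₁) (B u) 0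
    obtain ⟨z, h0, hz⟩ := exists_isotropic_add_smul B hB hBu hBy hy
    exact ⟨_, h0, by simp [hCu, hCy], hz⟩
  obtain ⟨e₃, hC₃, hB₃, hB₀₃⟩ : ∃ e₃ : V, C e₁ e₃ = 0 ∧ B e₃ e₃ = 0 ∧ B e₀ e₃ = 1 := by
    obtain ⟨y, hy⟩ : ∃ y, B e₀ y ≠ 0 := by
      by_contra! h
      exact hnondeg e₀ he₀ hC₀ (LinearMap.ext h)
    obtain ⟨u, hu, hCu⟩ : ∃ u, B e₀ u = 1 ∧ C e₁ u = 0 :=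
      ⟨(B e₀ y)⁻¹ • y + (C e₁ ((B e₀ y)⁻¹ • y)) • e₁, by simp [hB₁', hy], by simp [hC₁]⟩
    refine ⟨u - (B u u / 2) • e₀, by simp [hCu, hC₀], ?_, by simp [hB₀, hu]⟩
    simp only [map_sub, map_smul, LinearMap.sub_apply, LinearMap.smul_apply, smul_eq_mul, hB₀,
      hB u e₀, hu]
    ring
  obtain ⟨y, hy, hCy, hB₀y, hB₃y⟩ := exists_ne_zero_of_three_forms hV (C e₁) (B e₀) (B e₃)
  have hind (z : k) (hz : z ≠ 0) : LinearIndependent k ![e₀, e₁, z • y, e₃] := by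
    rw [Fintype.linearIndependent_iff]
    intro c hc
    simp only [Fin.sum_univ_four, Matrix.cons_val] at hc
    have h3 : c 3 = 0 := by simpa [hB₀, hB₁', hB₀y, hB₀₃] using congrArg (B e₀) hc
    have h0 : c 0 = 0 := by
      simpa [hB₃, hB₁', hB₃y, hB e₃ e₀, hB₀₃] using congrArg (B e₃) hc
    have h1 : c 1 = 0 := by simpa [hC₀, hC₃, hCy, hC₁] using congrArg (C e₁) hc
    have h2 : c 2 = 0 := by simpa [h0, h1, h3, hy, hz] using hc
    intro i
    fin_cases i <;> assumption
  have hext (z : k) (hz : z ≠ 0) (f : V →ₗ[k] k) (h0 : f e₀ = 0) (h1 : f e₁ = 0)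
      (h2 : f (z • y) = 0) (h3 : f e₃ = 0) : f = 0 := by
    refine (basisOfLinearIndependentOfCardEqFinrank (hind z hz) (by simp [hV])).ext fun i => ?_
    fin_cases i
    · simpa using h0
    · simpa using h1
    · simpa using h2
    · simpa using h3
  have hBy : B y y ≠ 0 := by
    intro h0
    exact hnondeg y hy hCy (hext 1 one_ne_zero _ (by rw [hB, hB₀y]) (hB₁' y) (by simpa using h0)
      (by rw [hB, hB₃y]))
  obtain ⟨z, hz0, hz⟩ := exists_smul_apply_self_eq B hBy (neg_ne_zero.2 (two_ne_zero (α := k)))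
  exact ⟨{
    e₀ := e₀
    e₁ := e₁
    e₂ := z • y
    e₃ := e₃
    ext := hext z hz0
    B_symm := hB
    C_symm := hC
    B₁ := hB₁
    B₀₀ := hB₀
    B₀₂ := by simp [hB₀y]
    B₀₃ := hB₀₃
    B₂₂ := hz
    B₂₃ := by simp [hB y e₃, hB₃y]
    B₃₃ := hB₃
    C₀₁ := by rw [hC, hC₀]
    C₁₁ := hC₁
    C₁₂ := by simp [hCy]
    C₁₃ := hC₃ }⟩

namespace ConeFrame

open Polynomial (derivative)

variable {B C : LinearMap.BilinForm k V} (F : ConeFrame B C)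

/-- The parametrization of the conic cut out by `B` in the span of `e₀, e₂, e₃`. -/
def conic (s : k) : V := F.e₀ + s • F.e₂ + s ^ 2 • F.e₃

/-- The derivative of `conic`. -/
def conicDeriv (s : k) : V := F.e₂ + (2 * s) • F.e₃

/-- The restriction of the quadratic form of `D` to `conic`. -/
def conicPoly (D : LinearMap.BilinForm k V) : Polynomial k :=
  Polynomial.C (D F.e₀ F.e₀) + Polynomial.C (2 * D F.e₀ F.e₂) * Polynomial.X
    + Polynomial.C (D F.e₂ F.e₂ + 2 * D F.e₀ F.e₃) * Polynomial.X ^ 2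
    + Polynomial.C (2 * D F.e₂ F.e₃) * Polynomial.X ^ 3
    + Polynomial.C (D F.e₃ F.e₃) * Polynomial.X ^ 4

/-- The restriction of `D` to the double cover `w ^ 2 = conicPoly C` is
`evenPart D + w * oddPart D`. -/
def evenPart (D : LinearMap.BilinForm k V) : Polynomial k :=
  F.conicPoly D + Polynomial.C (D F.e₁ F.e₁) * F.conicPoly C

/-- The coefficient of `w` in the restriction of `D` to the double cover. -/
def oddPart (D : LinearMap.BilinForm k V) : Polynomial k :=
  Polynomial.C (2 * D F.e₀ F.e₁) + Polynomial.C (2 * D F.e₁ F.e₂) * Polynomial.X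
    + Polynomial.C (2 * D F.e₁ F.e₃) * Polynomial.X ^ 2

lemma eval_conicPoly (D : LinearMap.BilinForm k V) (hD : ∀ x y, D x y = D y x) (s : k) :
    (F.conicPoly D).eval s = D (F.conic s) (F.conic s) := by
  simp [conicPoly, conic, hD F.e₂ F.e₀, hD F.e₃ F.e₀, hD F.e₃ F.e₂]
  ring

lemma eval_derivative_conicPoly (D : LinearMap.BilinForm k V) (hD : ∀ x y, D x y = D y x)
    (s : k) : (derivative (F.conicPoly D)).eval s = 2 * D (F.conic s) (F.conicDeriv s) := by
  simp [conicPoly, conic, conicDeriv, hD F.e₃ F.e₂]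
  ring

lemma eval_oddPart (D : LinearMap.BilinForm k V) (hD : ∀ x y, D x y = D y x) (s : k) :
    (F.oddPart D).eval s = 2 * D (F.conic s) F.e₁ := by
  simp [oddPart, conic, hD F.e₂ F.e₁, hD F.e₃ F.e₁]
  ring

lemma eval_derivative_oddPart (D : LinearMap.BilinForm k V) (hD : ∀ x y, D x y = D y x) (s : k) :
    (derivative (F.oddPart D)).eval s = 2 * D (F.conicDeriv s) F.e₁ := by
  simp [oddPart, conicDeriv, hD F.e₂ F.e₁, hD F.e₃ F.e₁]
  ring

lemma B_conic (s : k) : B (F.conic s) (F.conic s) = 0 := by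
  simp [conic, F.B_symm F.e₂ F.e₀, F.B_symm F.e₃ F.e₀, F.B_symm F.e₃ F.e₂, F.B₀₀, F.B₀₂, F.B₀₃,
    F.B₂₂, F.B₂₃, F.B₃₃]
  ring

lemma B_conic_conicDeriv (s : k) : B (F.conic s) (F.conicDeriv s) = 0 := by
  simp [conic, conicDeriv, F.B_symm F.e₃ F.e₂, F.B₀₂, F.B₀₃, F.B₂₂, F.B₂₃, F.B₃₃]
  ring

lemma B_conic_e₃ (s : k) : B (F.conic s) F.e₃ = 1 := by
  simp [conic, F.B₀₃, F.B₂₃, F.B₃₃]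

lemma B_apply_e₁ (x : V) : B x F.e₁ = 0 := by
  rw [F.B_symm, F.B₁, LinearMap.zero_apply]

lemma C_conic_e₁ (s : k) : C (F.conic s) F.e₁ = 0 := by
  simp [conic, F.C_symm F.e₂ F.e₁, F.C_symm F.e₃ F.e₁, F.C₀₁, F.C₁₂, F.C₁₃]

lemma C_conicDeriv_e₁ (s : k) : C (F.conicDeriv s) F.e₁ = 0 := by
  simp [conicDeriv, F.C_symm F.e₂ F.e₁, F.C_symm F.e₃ F.e₁, F.C₁₂, F.C₁₃]

lemma conic_ne_zero (s : k) : F.conic s ≠ 0 := fun h => by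
  simpa [h] using F.B_conic_e₃ s

lemma e₃_ne_zero : F.e₃ ≠ 0 := fun h => by
  simpa [h] using F.B₀₃

/-- A linear form vanishing on `conic s`, its derivative, `e₁` and `e₃` is zero. -/
lemma ext_conic (s : k) (f : V →ₗ[k] k) (h : f (F.conic s) = 0) (h' : f (F.conicDeriv s) = 0)
    (h₁ : f F.e₁ = 0) (h₃ : f F.e₃ = 0) : f = 0 := by
  have h₂ : f F.e₂ = 0 := by simpa [conicDeriv, h₃] using h'
  exact F.ext f (by simpa [conic, h₂, h₃] using h) h₁ h₂ h₃

/-- The branch quartic of the double cover has a simple root. -/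
lemma exists_simple_root [IsAlgClosed k] [CharZero k] (hBC : SmoothPencil B C) :
    ∃ s, (F.conicPoly C).eval s = 0 ∧ (derivative (F.conicPoly C)).eval s ≠ 0 := by
  obtain ⟨s, hs⟩ : ∃ s, (F.conicPoly C).eval s = 0 := by
    by_contra! hne
    have hdeg : (F.conicPoly C).degree = 0 := by
      by_contra hd
      obtain ⟨s, hs⟩ := IsAlgClosed.exists_root _ hd
      exact hne s hs
    have hconst := Polynomial.eq_C_of_degree_eq_zero hdeg
    have h3 := congrArg (Polynomial.coeff · 3) hconst
    have h4 := congrArg (Polynomial.coeff · 4) hconst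
    simp only [conicPoly, Polynomial.coeff_add, Polynomial.coeff_C_mul, Polynomial.coeff_X,
      Polynomial.coeff_C, Polynomial.coeff_X_pow] at h3 h4
    norm_num at h3 h4
    have h := hBC F.e₃ F.e₃_ne_zero F.B₃₃ h4 (C F.e₃ F.e₀) (-1) (F.ext _
      (by simp [F.B_symm F.e₃ F.e₀, F.B₀₃])
      (by simp [F.B_apply_e₁, F.C_symm F.e₃ F.e₁, F.C₁₃])
      (by simp [F.B_symm F.e₃ F.e₂, F.B₂₃, F.C_symm F.e₃ F.e₂, h3])
      (by simp [F.B₃₃, h4]))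
    exact neg_ne_zero.2 one_ne_zero h.2
  refine ⟨s, hs, fun hs' => ?_⟩
  rw [F.eval_conicPoly C F.C_symm] at hs
  rw [F.eval_derivative_conicPoly C F.C_symm] at hs'
  have hs'' := (mul_eq_zero.1 hs').resolve_left two_ne_zero
  have h := hBC (F.conic s) (F.conic_ne_zero s) (F.B_conic s) hs (C (F.conic s) F.e₃) (-1)
    (F.ext_conic s _
      (by simp [F.B_conic, hs])
      (by simp [F.B_conic_conicDeriv, hs''])
      (by simp [F.B_apply_e₁, F.C_conic_e₁])
      (by simp [F.B_conic_e₃]))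
  exact neg_ne_zero.2 one_ne_zero h.2

/-- A symmetric form vanishing on the double cover lies in the pencil. -/
lemma eq_of_evenPart_oddPart_eq_zero [CharZero k] (D : LinearMap.BilinForm k V)
    (hD : ∀ x y, D x y = D y x) (heven : F.evenPart D = 0) (hodd : F.oddPart D = 0) :
    ∃ a b : k, D = a • B + b • C := by
  have h2 : (2 : k) ≠ 0 := two_ne_zero
  have o0 := congrArg (Polynomial.coeff · 0) hodd
  have o1 := congrArg (Polynomial.coeff · 1) hodd
  have o2 := congrArg (Polynomial.coeff · 2) hodd
  have p0 := congrArg (Polynomial.coeff · 0) heven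
  have p1 := congrArg (Polynomial.coeff · 1) heven
  have p2 := congrArg (Polynomial.coeff · 2) heven
  have p3 := congrArg (Polynomial.coeff · 3) heven
  have p4 := congrArg (Polynomial.coeff · 4) heven
  simp only [oddPart, evenPart, conicPoly, Polynomial.coeff_add, Polynomial.coeff_C_mul,
    Polynomial.coeff_X, Polynomial.coeff_C, Polynomial.coeff_X_pow, Polynomial.coeff_zero]
    at o0 o1 o2 p0 p1 p2 p3 p4
  norm_num at o0 o1 o2 p0 p1 p2 p3 p4
  have q1 : D F.e₀ F.e₂ + D F.e₁ F.e₁ * C F.e₀ F.e₂ = 0 :=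
    mul_left_cancel₀ h2 (by linear_combination p1)
  have q3 : D F.e₂ F.e₃ + D F.e₁ F.e₁ * C F.e₂ F.e₃ = 0 :=
    mul_left_cancel₀ h2 (by linear_combination p3)
  refine ⟨D F.e₀ F.e₃ + D F.e₁ F.e₁ * C F.e₀ F.e₃, -D F.e₁ F.e₁, ?_⟩
  rw [← sub_eq_zero]
  set G := D - ((D F.e₀ F.e₃ + D F.e₁ F.e₁ * C F.e₀ F.e₃) • B + (-D F.e₁ F.e₁) • C) with hG
  have hGs (x y : V) : G x y = G y x := by
    simp [hG, hD x y, F.B_symm x y, F.C_symm x y]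
  have g00 : G F.e₀ F.e₀ = 0 := by simp [hG, F.B₀₀]; linear_combination p0
  have g01 : G F.e₀ F.e₁ = 0 := by simp [hG, F.B_apply_e₁, F.C₀₁, o0]
  have g02 : G F.e₀ F.e₂ = 0 := by simp [hG, F.B₀₂]; linear_combination q1
  have g03 : G F.e₀ F.e₃ = 0 := by simp [hG, F.B₀₃]
  have g11 : G F.e₁ F.e₁ = 0 := by simp [hG, F.B_apply_e₁, F.C₁₁]
  have g12 : G F.e₁ F.e₂ = 0 := by simp [hG, F.B₁, F.C₁₂, o1]
  have g13 : G F.e₁ F.e₃ = 0 := by simp [hG, F.B₁, F.C₁₃, o2]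
  have g22 : G F.e₂ F.e₂ = 0 := by simp [hG, F.B₂₂]; linear_combination p2
  have g23 : G F.e₂ F.e₃ = 0 := by simp [hG, F.B₂₃]; linear_combination q3
  have g33 : G F.e₃ F.e₃ = 0 := by simp [hG, F.B₃₃]; linear_combination p4
  have h0 : G F.e₀ = 0 := F.ext _ g00 g01 g02 g03
  have h1 : G F.e₁ = 0 := F.ext _ (by rw [hGs, g01]) g11 g12 g13
  have h2 : G F.e₂ = 0 := F.ext _ (by rw [hGs, g02]) (by rw [hGs, g12]) g22 g23
  have h3 : G F.e₃ = 0 := F.ext _ (by rw [hGs, g03]) (by rw [hGs, g13]) (by rw [hGs, g23]) g33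
  exact LinearMap.ext fun x => F.ext _ (by rw [hGs, h0]; rfl) (by rw [hGs, h1]; rfl)
    (by rw [hGs, h2]; rfl) (by rw [hGs, h3]; rfl)

/-- The Jacobian condition along the base curve of a smooth pencil: the forms `D` and `E` have
dependent differentials on the tangent directions. -/
lemma wronskian_eq_zero (hBC : SmoothPencil B C) {D E : LinearMap.BilinForm k V}
    (hdep : ∀ v, ∃ c : Fin 4 → k, c ≠ 0 ∧
      c 0 • B v + c 1 • C v + c 2 • D v + c 3 • E v = 0)
    {v t : V} (hv : v ≠ 0) (hBv : B v v = 0) (hCv : C v v = 0) (hBt : B v t = 0)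
    (hCt : C v t = 0) : D v v * E v t - E v v * D v t = 0 := by
  obtain ⟨c, hc, h⟩ := hdep v
  have h1 : c 2 * D v v + c 3 * E v v = 0 := by
    simpa [hBv, hCv] using congrArg (fun f : V →ₗ[k] k => f v) h
  have h2 : c 2 * D v t + c 3 * E v t = 0 := by
    simpa [hBt, hCt] using congrArg (fun f : V →ₗ[k] k => f t) h
  by_cases hc2 : c 2 = 0
  · by_cases hc3 : c 3 = 0
    · obtain ⟨h0, h1⟩ := hBC v hv hBv hCv (c 0) (c 1) (by simpa [hc2, hc3] using h)
      refine absurd (_root_.funext fun i => ?_) hc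
      fin_cases i <;> assumption
    · apply mul_left_cancel₀ hc3
      linear_combination D v v * h2 - D v t * h1
  · apply mul_left_cancel₀ hc2
    linear_combination E v t * h1 - E v v * h2

/-- If `B v, C v, D v, E v` are linearly dependent for all `v`, then a nontrivial combination of
`D` and `E` lies in the pencil. -/
lemma exists_combination_mem_pencil [IsAlgClosed k] [CharZero k] (F : ConeFrame B C)
    (hBC : SmoothPencil B C)
    {D E : LinearMap.BilinForm k V} (hD : ∀ x y, D x y = D y x) (hE : ∀ x y, E x y = E y x)
    (hdep : ∀ v, ∃ c : Fin 4 → k, c ≠ 0 ∧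
      c 0 • B v + c 1 • C v + c 2 • D v + c 3 • E v = 0) :
    ∃ α β a b : k, (α ≠ 0 ∨ β ≠ 0) ∧ α • D + β • E = a • B + b • C := by
  obtain ⟨s₀, hs₀, hs₀'⟩ := F.exists_simple_root hBC
  have hq : F.conicPoly C ≠ 0 := by intro h; simp [h] at hs₀'
  have h2 : (2 : k) ≠ 0 := two_ne_zero
  set q := F.conicPoly C with hqdef
  set P := F.evenPart D with hP
  set L := F.oddPart D with hL
  set M := F.evenPart E with hM
  set N := F.oddPart E with hN
  have hparts (s w : k) (hw : w ^ 2 = q.eval s) :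
      (P * (2 * q * derivative N + derivative q * N) + 2 * q * L * derivative M
        - M * (2 * q * derivative L + derivative q * L) - 2 * q * N * derivative P).eval s
      + w * (2 * (P * derivative M - M * derivative P)
        + 2 * q * (L * derivative N - N * derivative L)).eval s = 0 := by
    have hval (G : LinearMap.BilinForm k V) (hG : ∀ x y, G x y = G y x) :
        G (F.conic s + w • F.e₁) (F.conic s + w • F.e₁)
          = (F.evenPart G).eval s + w * (F.oddPart G).eval s := by
      rw [evenPart, Polynomial.eval_add, Polynomial.eval_mul, ← hqdef, ← hw, F.eval_conicPoly G hG,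
        F.eval_oddPart G hG]
      simp [hG F.e₁ (F.conic s)]
      ring
    have hder (G : LinearMap.BilinForm k V) (hG : ∀ x y, G x y = G y x) :
        2 * G (F.conic s + w • F.e₁)
            ((derivative q).eval s • F.e₁ + (2 * w) • F.conicDeriv s)
          = (derivative q).eval s * (F.oddPart G).eval s
            + 2 * w * (derivative (F.evenPart G)).eval s
            + 2 * q.eval s * (derivative (F.oddPart G)).eval s := by
      rw [evenPart, Polynomial.derivative_add, Polynomial.derivative_C_mul, Polynomial.eval_add,
        Polynomial.eval_mul, ← hqdef, ← hw, F.eval_derivative_conicPoly G hG, F.eval_oddPart G hG,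
        F.eval_derivative_oddPart G hG]
      simp [hG F.e₁ (F.conicDeriv s)]
      ring
    have hv : F.conic s + w • F.e₁ ≠ 0 := fun h0 => by
      simpa [F.B_conic_e₃, F.B₁] using congrArg (fun x => B x F.e₃) h0
    have hW := wronskian_eq_zero hBC hdep (v := F.conic s + w • F.e₁)
      (t := (derivative q).eval s • F.e₁ + (2 * w) • F.conicDeriv s) hv
      (by simp [F.B_conic, F.B_apply_e₁, F.B₁])
      (by
        simp [F.C_conic_e₁, F.C_symm F.e₁ (F.conic s), F.C₁₁, ← F.eval_conicPoly C F.C_symm,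
          ← hqdef, ← hw]
        ring)
      (by simp [F.B_conic_conicDeriv, F.B_apply_e₁, F.B₁])
      (by
        simp [F.C_conic_e₁, F.C_symm F.e₁ (F.conicDeriv s), F.C_conicDeriv_e₁, F.C₁₁, hqdef,
          F.eval_derivative_conicPoly C F.C_symm]
        ring)
    have hDv := hval D hD
    have hEv := hval E hE
    have hDt := hder D hD
    have hEt := hder E hE
    rw [← hP, ← hL] at hDv hDt
    rw [← hM, ← hN] at hEv hEt
    rw [hDv, hEv] at hW
    simp only [Polynomial.eval_add, Polynomial.eval_sub, Polynomial.eval_mul,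
      Polynomial.eval_ofNat]
    linear_combination 2 * hW - (P.eval s + w * L.eval s) * hEt
      + (M.eval s + w * N.eval s) * hDt
      + (2 * N.eval s * (derivative P).eval s - 2 * L.eval s * (derivative M).eval s) * hw
  have hboth (s : k) : ∃ w : k, w ^ 2 = q.eval s := IsAlgClosed.exists_pow_nat_eq _ two_pos
  obtain ⟨α, β, hαβ, hev, hod⟩ := exists_linear_relation_of_wronskian_double_cover
    (P := P) (L := L) (M := M) (N := N) hs₀ hs₀'
    (by
      refine Polynomial.funext fun s => ?_
      obtain ⟨w, hw⟩ := hboth s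
      have h₁ := hparts s w hw
      have h₂ := hparts s (-w) (by rw [neg_sq, hw])
      rw [Polynomial.eval_zero]
      apply mul_left_cancel₀ h2
      linear_combination h₁ + h₂)
    (by
      refine (mul_eq_zero.1 (?_ : q * _ = 0)).resolve_left hq
      refine Polynomial.funext fun s => ?_
      obtain ⟨w, hw⟩ := hboth s
      have h₁ := hparts s w hw
      have h₂ := hparts s (-w) (by rw [neg_sq, hw])
      rw [Polynomial.eval_zero, Polynomial.eval_mul, ← hw]
      apply mul_left_cancel₀ h2
      linear_combination w * (h₁ - h₂))
  obtain ⟨a, b, hab⟩ := F.eq_of_evenPart_oddPart_eq_zero (α • D + β • E)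
    (fun x y => by simp [hD x y, hE x y])
    (by
      rw [← hev, hP, hM]
      simp [evenPart, conicPoly]
      ring)
    (by
      rw [← hod, hL, hN]
      simp [oddPart]
      ring)
  exact ⟨α, β, a, b, hαβ, hab⟩

end ConeFrame

/-- A smooth pencil on a four-dimensional space over an algebraically closed field: if the
polars of `v` with respect to `B, C, D, E` are always dependent, so are the forms. -/
theorem SmoothPencil.exists_linear_relation [IsAlgClosed k] [CharZero k]
    (hV : Module.finrank k V = 4) {B C D E : LinearMap.BilinForm k V}
    (hB : ∀ x y, B x y = B y x) (hC : ∀ x y, C x y = C y x)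
    (hD : ∀ x y, D x y = D y x) (hE : ∀ x y, E x y = E y x) (hBC : SmoothPencil B C)
    (hdep : ∀ v, ∃ c : Fin 4 → k, c ≠ 0 ∧
      c 0 • B v + c 1 • C v + c 2 • D v + c 3 • E v = 0) :
    ∃ c : Fin 4 → k, c ≠ 0 ∧ c 0 • B + c 1 • C + c 2 • D + c 3 • E = 0 := by
  have : FiniteDimensional k V := Module.finite_of_finrank_pos (by omega)
  have : Nontrivial V := Module.nontrivial_of_finrank_pos (R := k) (by omega)
  have key {B' C' : LinearMap.BilinForm k V} (F : ConeFrame B' C') (hBC' : SmoothPencil B' C')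
      (hdep' : ∀ v, ∃ c : Fin 4 → k, c ≠ 0 ∧
        c 0 • B' v + c 1 • C' v + c 2 • D v + c 3 • E v = 0)
      (hspan : ∀ a b : k, ∃ a' b' : k, a • B' + b • C' = a' • B + b' • C) :
      ∃ c : Fin 4 → k, c ≠ 0 ∧ c 0 • B + c 1 • C + c 2 • D + c 3 • E = 0 := by
    obtain ⟨α, β, a, b, hαβ, h⟩ := F.exists_combination_mem_pencil hBC' hD hE hdep'
    obtain ⟨a', b', h'⟩ := hspan a b
    refine ⟨![-a', -b', α, β], fun h0 => ?_, ?_⟩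
    · have h2 : α = 0 := congrFun h0 2
      have h3 : β = 0 := congrFun h0 3
      exact hαβ.elim (· h2) (· h3)
    · simp only [Matrix.cons_val]
      rw [add_assoc _ (α • D), h, h']
      module
  by_cases hCinj : Function.Injective C
  · let Ce : V ≃ₗ[k] (V →ₗ[k] k) := LinearEquiv.ofInjectiveOfFinrankEq C hCinj (by
      exact (Subspace.dual_finrank_eq (K := k) (V := V)).symm)
    obtain ⟨μ, hμ⟩ := Module.End.exists_eigenvalue
      ((Ce.symm : (V →ₗ[k] k) →ₗ[k] V) ∘ₗ B : Module.End k V)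
    obtain ⟨e, he⟩ := hμ.exists_hasEigenvector
    have hBe : (B - μ • C) e = 0 := by
      have h := congrArg Ce he.apply_eq_smul
      rw [LinearMap.comp_apply, LinearEquiv.coe_coe, LinearEquiv.apply_symm_apply, map_smul] at h
      rw [LinearMap.sub_apply, LinearMap.smul_apply, h]
      exact sub_self _
    have hsm : SmoothPencil (B - μ • C) C := by
      intro v hv h1 h2 a b hab
      have h1' : B v v = 0 := by simpa [h2] using h1
      obtain ⟨ha, hb⟩ := hBC v hv h1' h2 a (b - a * μ) (by
        rw [← hab, LinearMap.sub_apply, LinearMap.smul_apply]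
        module)
      exact ⟨ha, by simpa [ha] using hb⟩
    obtain ⟨F⟩ := hsm.nonempty_coneFrame hV (fun x y => by simp [hB x y, hC x y]) hC he.2 hBe
    refine key F hsm (fun v => ?_) fun a b => ⟨a, b - a * μ, by module⟩
    obtain ⟨c, hc, h⟩ := hdep v
    refine ⟨![c 0, c 1 + c 0 * μ, c 2, c 3], fun h0 => hc ?_, ?_⟩
    · have h00 : c 0 = 0 := congrFun h0 0
      have h01 : c 1 + c 0 * μ = 0 := congrFun h0 1
      have h1 : c 1 = 0 := by simpa [h00] using h01
      have h2 : c 2 = 0 := congrFun h0 2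
      have h3 : c 3 = 0 := congrFun h0 3
      refine _root_.funext fun i => ?_
      fin_cases i <;> assumption
    · simp only [Matrix.cons_val]
      rw [← h, LinearMap.sub_apply, LinearMap.smul_apply]
      module
  · obtain ⟨e, he, he0⟩ : ∃ e, C e = 0 ∧ e ≠ 0 := by
      by_contra! h
      exact hCinj ((injective_iff_map_eq_zero C).2 h)
    have hsm : SmoothPencil C B := fun v hv h1 h2 a b hab =>
      (hBC v hv h2 h1 b a (by rw [← hab, add_comm])).symm
    obtain ⟨F⟩ := hsm.nonempty_coneFrame hV hC hB he0 he
    refine key F hsm (fun v => ?_) fun a b => ⟨b, a, add_comm _ _⟩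
    obtain ⟨c, hc, h⟩ := hdep v
    refine ⟨![c 1, c 0, c 2, c 3], fun h0 => hc ?_, ?_⟩
    · have h0' : c 0 = 0 := congrFun h0 1
      have h1 : c 1 = 0 := congrFun h0 0
      have h2 : c 2 = 0 := congrFun h0 2
      have h3 : c 3 = 0 := congrFun h0 3
      refine _root_.funext fun i => ?_
      fin_cases i <;> assumption
    · simp only [Matrix.cons_val]
      rw [← h]
      module

end BilinearForms

section Quadrics

variable {k : Type*} [Field k]

lemma pderiv_comm {σ : Type*} (i j : σ) (Q : MvPolynomial σ k) :
    pderiv i (pderiv j Q) = pderiv j (pderiv i Q) := by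
  classical
  have h : ⁅(pderiv i : Derivation k (MvPolynomial σ k) (MvPolynomial σ k)),
      (pderiv j : Derivation k (MvPolynomial σ k) (MvPolynomial σ k))⁆ = 0 := by
    refine MvPolynomial.derivation_ext fun l => ?_
    simp only [Derivation.commutator_apply, pderiv_X, Derivation.zero_apply]
    rw [Pi.single_apply, Pi.single_apply]
    split_ifs <;> simp
  have hQ := congrArg (fun D : Derivation k (MvPolynomial σ k) (MvPolynomial σ k) => D Q) h
  simpa only [Derivation.commutator_apply, Derivation.zero_apply, sub_eq_zero] using hQ

/-- The polar form of a quadratic form, with matrix the Hessian. -/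
def polarForm (Q : MvPolynomial (Fin 4) k) : LinearMap.BilinForm k (Fin 4 → k) :=
  Matrix.toBilin' (Matrix.of fun i j => constantCoeff (pderiv i (pderiv j Q)))

lemma polarForm_symm (Q : MvPolynomial (Fin 4) k) (x y : Fin 4 → k) :
    polarForm Q x y = polarForm Q y x := by
  simp only [polarForm, Matrix.toBilin'_apply, Matrix.of_apply]
  rw [Finset.sum_comm]
  refine Finset.sum_congr rfl fun i _ => Finset.sum_congr rfl fun j _ => ?_
  rw [pderiv_comm]
  ring

lemma polarForm_apply {Q : MvPolynomial (Fin 4) k} (hQ : Q.IsHomogeneous 2) (v x : Fin 4 → k) :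
    polarForm Q v x = ∑ j, gradEval Q v j * x j := by
  simp only [polarForm, Matrix.toBilin'_apply, Matrix.of_apply]
  rw [Finset.sum_comm]
  refine Finset.sum_congr rfl fun j _ => ?_
  have hlin : (pderiv j Q).IsHomogeneous 1 := hQ.pderiv
  have heuler := congrArg (eval v) hlin.sum_X_mul_pderiv
  rw [one_smul, map_sum] at heuler
  rw [gradEval, ← heuler, Finset.sum_mul]
  refine Finset.sum_congr rfl fun i _ => ?_
  have hconst : (pderiv i (pderiv j Q)).IsHomogeneous 0 := hlin.pderiv
  rw [← totalDegree_zero_iff_isHomogeneous, totalDegree_eq_zero_iff_eq_C] at hconst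
  rw [hconst]
  simp

lemma polarForm_self {Q : MvPolynomial (Fin 4) k} (hQ : Q.IsHomogeneous 2) (v : Fin 4 → k) :
    polarForm Q v v = 2 * eval v Q := by
  have heuler := congrArg (eval v) hQ.sum_X_mul_pderiv
  rw [map_sum] at heuler
  rw [polarForm_apply hQ]
  simpa [gradEval, mul_comm] using heuler

lemma gradEval_eq_polarForm {Q : MvPolynomial (Fin 4) k} (hQ : Q.IsHomogeneous 2)
    (v : Fin 4 → k) (i : Fin 4) : gradEval Q v i = polarForm Q v (Pi.single i 1) := by
  simp [polarForm_apply hQ, Pi.single_apply]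

lemma CutsOutEllipticCurve.smoothPencil [CharZero k] {Q₁ Q₂ : MvPolynomial (Fin 4) k}
    (h₁ : Q₁.IsHomogeneous 2) (h₂ : Q₂.IsHomogeneous 2) (h : CutsOutEllipticCurve Q₁ Q₂) :
    SmoothPencil (polarForm Q₁) (polarForm Q₂) := by
  intro v hv hv₁ hv₂ a b hab
  rw [polarForm_self h₁] at hv₁
  rw [polarForm_self h₂] at hv₂
  refine LinearIndependent.pair_iff.1 (h v hv ((mul_eq_zero.1 hv₁).resolve_left two_ne_zero)
    ((mul_eq_zero.1 hv₂).resolve_left two_ne_zero)) a b (_root_.funext fun i => ?_)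
  simpa [gradEval_eq_polarForm h₁, gradEval_eq_polarForm h₂] using
    congrArg (fun f : (Fin 4 → k) →ₗ[k] k => f (Pi.single i 1)) hab

lemma exists_polarForm_relation_of_quarticJacDet_eq_zero {Q₁ Q₂ Q₃ Q₄ : MvPolynomial (Fin 4) k}
    (h₁ : Q₁.IsHomogeneous 2) (h₂ : Q₂.IsHomogeneous 2)
    (h₃ : Q₃.IsHomogeneous 2) (h₄ : Q₄.IsHomogeneous 2)
    (h : quarticJacDet Q₁ Q₂ Q₃ Q₄ = 0) (v : Fin 4 → k) :
    ∃ c : Fin 4 → k, c ≠ 0 ∧ c 0 • polarForm Q₁ v + c 1 • polarForm Q₂ v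
      + c 2 • polarForm Q₃ v + c 3 • polarForm Q₄ v = 0 := by
  have hdet := congrArg (eval v) h
  rw [quarticJacDet, RingHom.map_det, map_zero] at hdet
  obtain ⟨c, hc, hcv⟩ := Matrix.exists_mulVec_eq_zero_iff.2 hdet
  refine ⟨c, hc, LinearMap.pi_ext' fun i => LinearMap.ext_ring ?_⟩
  have hi := congrFun hcv i
  simp only [Matrix.mulVec, dotProduct, Fin.sum_univ_four, RingHom.mapMatrix_apply,
    Matrix.map_apply, Matrix.of_apply, Matrix.cons_val, Pi.zero_apply] at hi
  simp only [LinearMap.comp_apply, LinearMap.single_apply, LinearMap.add_apply,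
    LinearMap.smul_apply, smul_eq_mul, LinearMap.zero_apply, ← gradEval_eq_polarForm h₁,
    ← gradEval_eq_polarForm h₂, ← gradEval_eq_polarForm h₃, ← gradEval_eq_polarForm h₄, gradEval]
  linear_combination hi

lemma quarticJacDet_eq_zero_of_relation {Q₁ Q₂ Q₃ Q₄ : MvPolynomial (Fin 4) k} {c : Fin 4 → k}
    (hc : c ≠ 0) (h : ∑ j, c j • ![Q₁, Q₂, Q₃, Q₄] j = 0) : quarticJacDet Q₁ Q₂ Q₃ Q₄ = 0 := by
  refine Matrix.exists_mulVec_eq_zero_iff.1 ⟨fun j => C (c j), fun h0 => hc ?_, ?_⟩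
  · exact _root_.funext fun j => C_injective (Fin 4) k (by simpa using congrFun h0 j)
  · refine _root_.funext fun i => ?_
    have hi := congrArg (pderiv i) h
    rw [map_sum, map_zero] at hi
    rw [Pi.zero_apply, ← hi, Matrix.mulVec, dotProduct]
    refine Finset.sum_congr rfl fun j _ => ?_
    rw [Derivation.map_smul, smul_eq_C_mul, mul_comm, Matrix.of_apply]

end Quadrics

/-- For quadrics cutting out two normal elliptic curves in `P³`, the quartic Jacobian
determinant `F_{Q₁,Q₂,Q₃,Q₄}` vanishes identically iff `Q₁, Q₂, Q₃, Q₄` are linearly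
dependent. -/
theorem quartic_zero_iff_linearDependent {k : Type*} [Field k] [IsAlgClosed k] [CharZero k]
    (Q₁ Q₂ Q₃ Q₄ : MvPolynomial (Fin 4) k)
    (h₁ : Q₁.IsHomogeneous 2) (h₂ : Q₂.IsHomogeneous 2)
    (h₃ : Q₃.IsHomogeneous 2) (h₄ : Q₄.IsHomogeneous 2)
    (hE₁ : CutsOutEllipticCurve Q₁ Q₂) (hE₂ : CutsOutEllipticCurve Q₃ Q₄) :
    quarticJacDet Q₁ Q₂ Q₃ Q₄ = 0 ↔ ¬ LinearIndependent k ![Q₁, Q₂, Q₃, Q₄] := by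
  constructor
  · intro hF
    obtain ⟨c, hc, h⟩ := (hE₁.smoothPencil h₁ h₂).exists_linear_relation (by simp)
      (polarForm_symm Q₁) (polarForm_symm Q₂) (polarForm_symm Q₃) (polarForm_symm Q₄)
      (exists_polarForm_relation_of_quarticJacDet_eq_zero h₁ h₂ h₃ h₄ hF)
    intro hind
    rw [Fintype.linearIndependent_iff] at hind
    refine hc (_root_.funext (hind c (MvPolynomial.funext fun v => ?_)))
    have hv := congrArg (fun G : LinearMap.BilinForm k (Fin 4 → k) => G v v) h
    simp only [LinearMap.add_apply, LinearMap.smul_apply, smul_eq_mul, LinearMap.zero_apply,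
      polarForm_self h₁, polarForm_self h₂, polarForm_self h₃, polarForm_self h₄] at hv
    simp only [Fin.sum_univ_four, Matrix.cons_val, map_add, smul_eval, map_zero]
    apply mul_left_cancel₀ (two_ne_zero (α := k))
    linear_combination hv
  · intro hdep
    rw [Fintype.linearIndependent_iff] at hdep
    push Not at hdep
    obtain ⟨c, hc, i, hi⟩ := hdep
    exact quarticJacDet_eq_zero_of_relation (fun h0 => hi (congrFun h0 i)) hc
end
end

section
/- Let k be a field of characteristic zero, W a finite-dimensional k-vector space, and B : ⋀²W × ⋀²W → k a bilinear form such that B(u∧a, u∧b) = 0 for all u,a,b ∈ W (i.e., B vanishes on every pair of decomposable bivectors whose corresponding 2-dimensional subspaces of W intersect nontrivially). Then there exists a linear functional μ : ⋀⁴W → k such that B(w₁∧w₂, w₃∧w₄) = μ(w₁∧w₂∧w₃∧w₄) for all w₁,w₂,w₃,w₄ ∈ W; equivalently, B(ω,η) = μ(ω∧η) for all ω,η ∈ ⋀²W. -/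
open ExteriorAlgebra

noncomputable section

/-- The wedge product `v 0 ∧ ⋯ ∧ v (n-1)` as an element of the `n`-th exterior power
`⋀[k]^n W` (a submodule of the exterior algebra). -/
def wedge {k W : Type*} [Field k] [AddCommGroup W] [Module k W] (n : ℕ)
    (v : Fin n → W) : ⋀[k]^n W :=
  ⟨ExteriorAlgebra.ιMulti k n v, ExteriorAlgebra.ιMulti_range k n (Set.mem_range_self v)⟩

section Wedge

variable {k W : Type*} [Field k] [AddCommGroup W] [Module k W]

theorem wedge_eq_ιMulti (n : ℕ) (v : Fin n → W) :
    wedge n v = exteriorPower.ιMulti k n v := rfl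

theorem wedge_two_self (a : W) : wedge (k := k) 2 ![a, a] = 0 := by
  rw [wedge_eq_ιMulti]
  exact (exteriorPower.ιMulti k 2).map_eq_zero_of_eq _ (i := 0) (j := 1) rfl (by decide)

theorem wedge_two_add_left (a b c : W) :
    wedge (k := k) 2 ![a + b, c] = wedge 2 ![a, c] + wedge 2 ![b, c] := by
  simpa only [wedge_eq_ιMulti] using (exteriorPower.ιMulti k 2).map_vecCons_add ![c] a b

theorem wedge_two_smul_left (r : k) (a c : W) :
    wedge (k := k) 2 ![r • a, c] = r • wedge 2 ![a, c] := by
  simpa only [wedge_eq_ιMulti] using (exteriorPower.ιMulti k 2).map_vecCons_smul ![c] r a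

theorem wedge_two_swap (a b : W) : wedge (k := k) 2 ![a, b] = -wedge 2 ![b, a] := by
  have h := (exteriorPower.ιMulti k 2).map_swap ![b, a] (i := 0) (j := 1) (by decide)
  have hv : ![b, a] ∘ Equiv.swap (0 : Fin 2) 1 = ![a, b] := by
    ext i
    fin_cases i <;> simp
  rwa [hv] at h

theorem wedge_two_add_right (a b c : W) :
    wedge (k := k) 2 ![a, b + c] = wedge 2 ![a, b] + wedge 2 ![a, c] := by
  rw [wedge_two_swap, wedge_two_add_left, neg_add, ← wedge_two_swap, ← wedge_two_swap]

theorem wedge_two_smul_right (r : k) (a b : W) :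
    wedge (k := k) 2 ![a, r • b] = r • wedge 2 ![a, b] := by
  rw [wedge_two_swap a (r • b), wedge_two_smul_left, wedge_two_swap a b]
  exact (smul_neg r _).symm

/-- The alternating 4-form `(w₁, w₂, w₃, w₄) ↦ B (w₁ ∧ w₂) (w₃ ∧ w₄)` of a bilinear form `B` on
bivectors that vanishes on pairs of decomposable bivectors with a common factor. -/
def incidenceAlternatingMap (B : ⋀[k]^2 W →ₗ[k] ⋀[k]^2 W →ₗ[k] k)
    (hB : ∀ u a b : W, B (wedge 2 ![u, a]) (wedge 2 ![u, b]) = 0) : W [⋀^Fin 4]→ₗ[k] k where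
  toFun v := B (wedge 2 ![v 0, v 1]) (wedge 2 ![v 2, v 3])
  map_update_add' := by
    intro inst v i x y
    cases Subsingleton.elim inst (instDecidableEqFin 4)
    fin_cases i <;>
      simp [wedge_two_add_left, wedge_two_add_right]
  map_update_smul' := by
    intro inst v i r x
    cases Subsingleton.elim inst (instDecidableEqFin 4)
    fin_cases i <;>
      simp [wedge_two_smul_left, wedge_two_smul_right]
  map_eq_zero_of_eq' v i j hv hij := by
    have first_last (u a b : W) : B (wedge 2 ![u, a]) (wedge 2 ![b, u]) = 0 := by
      rw [wedge_two_swap b u, map_neg, hB, neg_zero]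
    have second_first (u a b : W) : B (wedge 2 ![a, u]) (wedge 2 ![u, b]) = 0 := by
      rw [wedge_two_swap a u, map_neg, LinearMap.neg_apply, hB, neg_zero]
    have second_last (u a b : W) : B (wedge 2 ![a, u]) (wedge 2 ![b, u]) = 0 := by
      rw [wedge_two_swap b u, map_neg, second_first, neg_zero]
    fin_cases i <;> fin_cases j <;>
      simp_all [wedge_two_self]

end Wedge

/-- A bilinear form on `⋀²W` vanishing on every pair of decomposable bivectors whose
corresponding planes intersect nontrivially factors through the wedge product
`⋀²W ⊗ ⋀²W → ⋀⁴W`: it is of the form `B(ω,η) = μ(ω∧η)` for a linear functional `μ`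
on `⋀⁴W`. -/
theorem bilinear_vanishing_on_incidence {k W : Type*} [Field k] [CharZero k]
    [AddCommGroup W] [Module k W] [FiniteDimensional k W]
    (B : ⋀[k]^2 W →ₗ[k] ⋀[k]^2 W →ₗ[k] k)
    (hB : ∀ u a b : W, B (wedge 2 ![u, a]) (wedge 2 ![u, b]) = 0) :
    ∃ μ : ⋀[k]^4 W →ₗ[k] k, ∀ w₁ w₂ w₃ w₄ : W,
      B (wedge 2 ![w₁, w₂]) (wedge 2 ![w₃, w₄]) = μ (wedge 4 ![w₁, w₂, w₃, w₄]) := by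
  refine ⟨exteriorPower.alternatingMapLinearEquiv (incidenceAlternatingMap B hB),
    fun w₁ w₂ w₃ w₄ => ?_⟩
  rw [wedge_eq_ιMulti 4, exteriorPower.alternatingMapLinearEquiv_apply_ιMulti]
  rfl
end
end
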